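/- arXiv:1105.6279 — 6 statements merged into one kernel-verified Lean document; each statement's English description precedes it below -/
import Mathlib

section
/- For |q| < 1, the logarithmic derivative of θ₄ satisfies θ₄'(z)/θ₄(z) = 4·∑_{n=1}^∞ (q^n/(1−q^{2n}))·sin(2nz) for all real z. -/
noncomputable def aa (q : ℝ) (n : ℤ) : ℝ := (-1) ^ n * q ^ (n ^ 2)
noncomputable def tt (q : ℝ) (m : ℤ) : ℝ := q ^ m / (1 - q ^ (2 * m))

lemma sum_L (q : ℝ) (hq0 : 0 < q) (hq1 : q < 1) (k : ℕ) (c : ℤ) :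
    Summable (fun n : ℤ => |(n : ℝ)| ^ k * q ^ (n ^ 2 + c * n)) := by
  have hl : Real.log q < 0 := Real.log_neg hq0 hq1
  have hT : 0 < - Real.log q / Real.pi := div_pos (by linarith) Real.pi_pos
  have h := summable_pow_mul_jacobiTheta₂_term_bound (|(c : ℝ)| * (- Real.log q / Real.pi) / 2) hT k
  refine Summable.of_nonneg_of_le (fun n => by positivity) (fun n => ?_) h
  push_cast
  gcongr
  rw [← Real.rpow_intCast, Real.rpow_def_of_pos hq0]
  apply Real.exp_le_exp.2
  push_cast
  have e : -Real.pi * (-Real.log q / Real.pi * (n:ℝ) ^ 2 - 2 * (|(c : ℝ)| * (-Real.log q / Real.pi) / 2) * |(n:ℝ)|)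
     = Real.log q * (n ^ 2 - |(c:ℝ)| * |(n:ℝ)|) := by
    field_simp
    ring
  rw [e]
  apply mul_le_mul_of_nonpos_left _ hl.le
  rw [← abs_mul]
  linarith [neg_abs_le ((c:ℝ) * n)]

lemma tt_neg (q : ℝ) (hq0 : 0 < q) (m : ℤ) : tt q (-m) = - tt q m := by
  unfold tt
  have h : q ^ m ≠ 0 := (zpow_pos hq0 m).ne'
  rw [mul_neg, zpow_neg, zpow_neg, mul_comm 2 m, zpow_mul]
  have e2 : (q ^ m) ^ (2:ℤ) = (q ^ m) ^ 2 := by norm_cast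
  rw [e2]
  generalize q ^ m = x at *
  by_cases h1 : 1 - x ^ 2 = 0
  · have : x ^ 2 = 1 := by linarith
    simp [this]
  · have h2 : 1 - (x ^ 2)⁻¹ ≠ 0 := by
      intro h3
      apply h1
      field_simp at h3
      linarith
    have h4 : x ^ 2 - 1 ≠ 0 := by
      intro h3
      apply h1; linarith
    have : 1 - (x ^ 2)⁻¹ = (x ^ 2 - 1) / x ^ 2 := by field_simp
    rw [this]
    field_simp
    ring

lemma tt_zero (q : ℝ) : tt q 0 = 0 := by simp [tt]

lemma tt_nat (q : ℝ) (hq0 : 0 < q) (hq1 : q < 1) (n : ℕ) :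
    |tt q n| ≤ q ^ n / (1 - q ^ 2) := by
  have h2 : 0 < 1 - q ^ 2 := by nlinarith
  rcases Nat.eq_zero_or_pos n with rfl | hn
  · simp [tt_zero, h2.le]
  unfold tt
  have e : q ^ (2 * (n:ℤ)) = q ^ (2 * n) := by norm_cast
  have : q ^ (2 * n) ≤ q ^ 2 := pow_le_pow_of_le_one hq0.le hq1.le (by omega)
  rw [e, zpow_natCast, abs_of_nonneg (div_nonneg (by positivity) (by linarith))]
  gcongr

lemma tt_bd (q : ℝ) (hq0 : 0 < q) (hq1 : q < 1) (m : ℤ) : |tt q m| ≤ 1 / (1 - q ^ 2) := by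
  have h2 : 0 < 1 - q ^ 2 := by nlinarith
  have key : ∀ n : ℕ, |tt q n| ≤ 1 / (1 - q ^ 2) := fun n =>
    (tt_nat q hq0 hq1 n).trans (by gcongr; exact pow_le_one₀ hq0.le hq1.le)
  rcases Int.eq_nat_or_neg m with ⟨n, rfl | rfl⟩
  · exact key n
  · rw [tt_neg q hq0, abs_neg]; exact key n

lemma tt_sum (q : ℝ) (hq0 : 0 < q) (hq1 : q < 1) : Summable (fun m => |tt q m|) := by
  have key : Summable (fun n : ℕ => |tt q n|) :=
    Summable.of_nonneg_of_le (fun _ => abs_nonneg _) (tt_nat q hq0 hq1)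
      ((summable_geometric_of_lt_one hq0.le hq1).div_const _)
  refine Summable.of_nat_of_neg key ?_
  simpa [tt_neg q hq0] using key

lemma aa_abs (q : ℝ) (hq0 : 0 < q) (n : ℤ) : |aa q n| = q ^ (n ^ 2) := by
  unfold aa
  rw [abs_mul, abs_zpow, abs_neg, abs_one, one_zpow, one_mul, abs_of_pos (zpow_pos hq0 _)]

lemma aa_neg (q : ℝ) (n : ℤ) : aa q (-n) = aa q n := by
  unfold aa
  rw [zpow_neg, neg_sq]
  congr 1
  rw [← inv_zpow]; norm_num

lemma aa_sum (q : ℝ) (hq0 : 0 < q) (hq1 : q < 1) : Summable (fun m => |aa q m|) := by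
  simpa [aa_abs q hq0] using sum_L q hq0 hq1 0 0

/-- convolution kernel -/
noncomputable def gg (q : ℝ) (n m : ℤ) : ℝ := tt q m * ((-1) ^ m * q ^ (m ^ 2 - 2 * n * m))

lemma gg_summable (q : ℝ) (hq0 : 0 < q) (hq1 : q < 1) (n : ℤ) : Summable (gg q n) := by
  have h := (sum_L q hq0 hq1 0 (-2 * n)).mul_left (1 / (1 - q ^ 2))
  refine Summable.of_norm_bounded h (fun m => ?_)
  unfold gg
  rw [Real.norm_eq_abs, abs_mul, abs_mul, abs_zpow, abs_neg, abs_one, one_zpow, one_mul,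
    abs_of_pos (zpow_pos hq0 _), pow_zero, one_mul]
  have : m ^ 2 - 2 * n * m = m ^ 2 + -2 * n * m := by ring
  rw [this]
  exact mul_le_mul_of_nonneg_right (tt_bd q hq0 hq1 m) (zpow_pos hq0 _).le

lemma tsum_odd (f : ℤ → ℝ) (h : ∀ m, f (-m) = - f m) : ∑' m, f m = 0 := by
  have := (Equiv.neg ℤ).tsum_eq f
  simp only [Equiv.neg_apply, h, tsum_neg] at this
  linarith

lemma gg_zero (q : ℝ) (hq0 : 0 < q) : ∑' m, gg q 0 m = 0 := by
  apply tsum_odd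
  intro m
  have : ((-1:ℝ)) ^ (-m) = (-1) ^ m := by rw [zpow_neg, ← inv_zpow]; norm_num
  simp [gg, tt_neg q hq0, this]

lemma anti (q : ℝ) (n : ℤ) :
    ∑' m : ℤ, (-1 : ℝ) ^ m * q ^ (m ^ 2 - m - 2 * n * m) = 0 := by
  set f : ℤ → ℝ := fun m => (-1 : ℝ) ^ m * q ^ (m ^ 2 - m - 2 * n * m) with hf
  have := (Equiv.subLeft (2 * n + 1)).tsum_eq f
  have h2 : ∀ m, f (2 * n + 1 - m) = - f m := by
    intro m
    have e1 : (-1 : ℝ) ^ (2 * n + 1 - m) = - (-1) ^ m := by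
      rw [zpow_sub₀ (by norm_num), zpow_add₀ (by norm_num), zpow_mul]
      have : ((-1:ℝ)) ^ (-m) = (-1) ^ m := by rw [zpow_neg, ← inv_zpow]; norm_num
      rw [zpow_neg] at this
      rw [div_eq_mul_inv, this]
      norm_num
    simp only [hf, e1]
    rw [neg_mul]
    congr 3
    ring
  simp only [Equiv.subLeft_apply, h2, tsum_neg] at this
  change ∑' m, f m = 0
  linarith

lemma gg_step (q : ℝ) (hq0 : 0 < q) (hq1 : q < 1) (n : ℤ) :
    ∑' m, gg q (n + 1) m = ∑' m, gg q n m - 1 := by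
  have hs : Summable (fun m : ℤ => (-1 : ℝ) ^ m * q ^ (m ^ 2 - m - 2 * n * m)) := by
    refine Summable.of_norm_bounded (sum_L q hq0 hq1 0 (-1 - 2 * n)) (fun m => ?_)
    rw [Real.norm_eq_abs, abs_mul, abs_zpow, abs_neg, abs_one, one_zpow, one_mul,
      abs_of_pos (zpow_pos hq0 _), pow_zero, one_mul]
    apply le_of_eq; congr 1; ring
  have hd : ∀ m, gg q (n + 1) m - gg q n m
      = (-1 : ℝ) ^ m * q ^ (m ^ 2 - m - 2 * n * m) - if m = 0 then 1 else 0 := by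
    intro m
    by_cases hm : m = 0
    · subst hm; simp [gg, tt_zero]
    · have h1 : 1 - q ^ (2 * m) ≠ 0 := by
        intro h
        have : q ^ (2 * m) = 1 := by linarith
        rw [zpow_eq_one_iff_right₀ hq0.le hq1.ne] at this
        omega
      have e1 : q ^ (m ^ 2 - 2 * (n + 1) * m) = q ^ (m ^ 2 - m - 2 * n * m) / q ^ m := by
        rw [← zpow_sub₀ hq0.ne']; congr 1; ring
      have e2 : q ^ (m ^ 2 - 2 * n * m) = q ^ (m ^ 2 - m - 2 * n * m) * q ^ m := by
        rw [← zpow_add₀ hq0.ne']; congr 1; ring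
      have e3 : q ^ (2 * m) = (q ^ m) ^ 2 := by rw [mul_comm, zpow_mul]; norm_cast
      have h : q ^ m ≠ 0 := (zpow_pos hq0 m).ne'
      simp only [gg, tt, hm, if_false, e1, e2]
      rw [e3] at h1 ⊢
      field_simp
      ring
  have h1 := (gg_summable q hq0 hq1 (n + 1)).tsum_sub (gg_summable q hq0 hq1 n)
  have h2 : Summable (fun m : ℤ => if m = 0 then (1 : ℝ) else 0) :=
    (hasSum_ite_eq (0:ℤ) (1:ℝ)).summable
  rw [tsum_congr hd, hs.tsum_sub h2, anti q, tsum_ite_eq] at h1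
  linarith

lemma gg_eq (q : ℝ) (hq0 : 0 < q) (hq1 : q < 1) (n : ℤ) : ∑' m, gg q n m = - n := by
  induction n using Int.induction_on with
  | zero => simp [gg_zero q hq0]
  | succ k ih => rw [gg_step q hq0 hq1, ih]; push_cast; ring
  | pred k ih =>
    have := gg_step q hq0 hq1 (-(k:ℤ) - 1)
    rw [sub_add_cancel, ih] at this
    push_cast at this ⊢
    linarith

noncomputable def th (q w : ℝ) : ℝ := ∑' n : ℤ, aa q n * Real.cos (2 * n * w)
noncomputable def sg (q w : ℝ) : ℝ := ∑' n : ℤ, tt q n * Real.sin (2 * n * w)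

lemma mul_bd (a x : ℝ) (hx : |x| ≤ 1) : ‖a * x‖ ≤ |a| := by
  rw [Real.norm_eq_abs, abs_mul]
  exact mul_le_of_le_one_right (abs_nonneg a) hx

lemma norm_sum (u : ℤ → ℝ) (hu : Summable fun m => |u m|) (x : ℤ → ℝ) (hx : ∀ m, |x m| ≤ 1) :
    Summable (fun m => ‖u m * x m‖) :=
  Summable.of_nonneg_of_le (fun _ => norm_nonneg _) (fun m => mul_bd _ _ (hx m)) hu

lemma aa_conv (q : ℝ) (hq0 : 0 < q) (k m : ℤ) :
    tt q m * aa q (k - m) = aa q k * gg q k m := by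
  unfold gg aa
  have e1 : ((-1:ℝ)) ^ (k - m) = (-1) ^ k * (-1) ^ m := by
    rw [zpow_sub₀ (by norm_num), div_eq_mul_inv, ← inv_zpow]; norm_num
  have e2 : q ^ ((k - m) ^ 2) = q ^ (k ^ 2) * q ^ (m ^ 2 - 2 * k * m) := by
    rw [← zpow_add₀ hq0.ne']; congr 1; ring
  rw [e1, e2]; ring

lemma th_mul_sg (q : ℝ) (hq0 : 0 < q) (hq1 : q < 1) (w : ℝ) :
    sg q w * th q w = ∑' k : ℤ, aa q k * (-k) * Real.sin (2 * k * w) := by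
  have hsin := fun m : ℤ => Real.abs_sin_le_one (2 * m * w)
  have hcos := fun m : ℤ => Real.abs_cos_le_one (2 * m * w)
  have ht := tt_sum q hq0 hq1
  have ha := aa_sum q hq0 hq1
  have t1 := norm_sum _ ht _ hsin
  have t2 := norm_sum _ ht _ hcos
  have a1 := norm_sum _ ha _ hsin
  have a2 := norm_sum _ ha _ hcos
  have P1 := tsum_mul_tsum_of_summable_norm t1 a2
  have P2 := tsum_mul_tsum_of_summable_norm t2 a1
  have S1 := summable_mul_of_summable_norm t1 a2
  have S2 := summable_mul_of_summable_norm t2 a1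
  have z0 : ∑' m : ℤ, aa q m * Real.sin (2 * m * w) = 0 := by
    apply tsum_odd
    intro m
    rw [aa_neg]; push_cast
    rw [show 2 * -(m:ℝ) * w = -(2 * m * w) by ring, Real.sin_neg]; ring
  rw [z0, mul_zero] at P2
  unfold sg th
  rw [P1, ← add_zero (∑' z : ℤ × ℤ, _), P2, ← S1.tsum_add S2]
  have S3 := S1.add S2
  let e : ℤ × ℤ ≃ ℤ × ℤ :=
    { toFun := fun p => (p.2, p.1 - p.2)
      invFun := fun p => (p.1 + p.2, p.1)
      left_inv := fun p => by simp
      right_inv := fun p => by simp }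
  rw [← e.tsum_eq]
  have S4 := e.summable_iff.2 S3
  have key : ∀ p : ℤ × ℤ, (tt q (e p).1 * Real.sin (2 * (e p).1 * w)) * (aa q (e p).2 * Real.cos (2 * (e p).2 * w))
      + (tt q (e p).1 * Real.cos (2 * (e p).1 * w)) * (aa q (e p).2 * Real.sin (2 * (e p).2 * w))
      = aa q p.1 * Real.sin (2 * p.1 * w) * gg q p.1 p.2 := by
    rintro ⟨k, m⟩
    have h := aa_conv q hq0 k m
    have h2 : Real.sin (2 * k * w) = Real.sin (2 * m * w + 2 * ((k - m : ℤ) : ℝ) * w) := by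
      congr 1; push_cast; ring
    rw [Real.sin_add] at h2
    change (tt q m * Real.sin (2 * m * w)) * (aa q (k - m) * Real.cos (2 * (k - m : ℤ) * w))
      + (tt q m * Real.cos (2 * m * w)) * (aa q (k - m) * Real.sin (2 * (k - m : ℤ) * w))
      = aa q k * Real.sin (2 * k * w) * gg q k m
    rw [h2]
    linear_combination (Real.sin (2 * m * w) * Real.cos (2 * (k - m : ℤ) * w) + Real.cos (2 * m * w) * Real.sin (2 * (k - m : ℤ) * w)) * h
  have S5 : Summable (fun p : ℤ × ℤ => aa q p.1 * Real.sin (2 * p.1 * w) * gg q p.1 p.2) :=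
    S4.congr (fun p => (key p))
  rw [tsum_congr key, S5.tsum_prod]
  refine tsum_congr (fun k => ?_)
  change ∑' c : ℤ, aa q k * Real.sin (2 * k * w) * gg q k c = _
  rw [tsum_mul_left, gg_eq q hq0 hq1]
  ring

lemma th_deriv (q : ℝ) (hq0 : 0 < q) (hq1 : q < 1) (w : ℝ) :
    HasDerivAt (th q) (2 * sg q w * th q w) w := by
  have hu : Summable (fun n : ℤ => 2 * (|(n : ℝ)| ^ 1 * q ^ (n ^ 2 + 0 * n))) :=
    (sum_L q hq0 hq1 1 0).mul_left 2
  have h := hasDerivAt_tsum (g := fun (n : ℤ) w => aa q n * Real.cos (2 * n * w))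
    (g' := fun (n : ℤ) w => aa q n * (-Real.sin (2 * n * w) * (2 * n))) (y₀ := 0) hu
    (fun n y => by
      have := (((hasDerivAt_id y).const_mul (2 * (n:ℝ))).cos).const_mul (aa q n)
      simpa using this)
    (fun n y => by
      rw [Real.norm_eq_abs, abs_mul, abs_mul, aa_abs q hq0, abs_neg, abs_mul, abs_two, pow_one, zero_mul,
        add_zero]
      have h1 := Real.abs_sin_le_one (2 * n * y)
      have h2 : 0 ≤ q ^ (n ^ 2) * (2 * |(n:ℝ)|) := by positivity
      nlinarith)
    (norm_sum _ (aa_sum q hq0 hq1) _ (fun n => Real.abs_cos_le_one _)).of_norm w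
  have e : 2 * sg q w * th q w = ∑' n : ℤ, aa q n * (-Real.sin (2 * n * w) * (2 * n)) := by
    rw [mul_assoc, th_mul_sg q hq0 hq1, ← tsum_mul_left]
    exact tsum_congr fun k => by ring
  rw [e]
  exact h

lemma sg_cont (q : ℝ) (hq0 : 0 < q) (hq1 : q < 1) : Continuous (sg q) := by
  unfold sg
  exact continuous_tsum (fun n => by fun_prop) (tt_sum q hq0 hq1)
    (fun n x => mul_bd _ _ (Real.abs_sin_le_one _))

lemma th_ne (q : ℝ) (hq0 : 0 < q) (hq1 : q < 1) (w : ℝ) : th q w ≠ 0 := by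
  have hc := sg_cont q hq0 hq1
  have hE : ∀ x, HasDerivAt (fun y => ∫ t in (0:ℝ)..y, sg q t) (sg q x) x := fun x =>
    intervalIntegral.integral_hasDerivAt_right (hc.intervalIntegrable _ _)
      (hc.stronglyMeasurableAtFilter _ _) hc.continuousAt
  set E : ℝ → ℝ := fun y => ∫ t in (0:ℝ)..y, sg q t
  have hP : ∀ x, HasDerivAt (fun y => th q y * Real.exp (-2 * E y)) 0 x := by
    intro x
    have := (th_deriv q hq0 hq1 x).mul (((hE x).const_mul (-2)).exp)
    exact this.congr_deriv (by ring)
  have hconst := is_const_of_deriv_eq_zero (fun x => (hP x).differentiableAt)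
    (fun x => (hP x).deriv) w (Real.pi / 2)
  have hpos : 0 < th q (Real.pi / 2) := by
    have hterm : ∀ n : ℤ, aa q n * Real.cos (2 * n * (Real.pi / 2)) = q ^ (n ^ 2) := by
      intro n
      rw [show 2 * (n:ℝ) * (Real.pi / 2) = n * Real.pi by ring, Real.cos_int_mul_pi]
      unfold aa
      rw [mul_right_comm, ← mul_zpow]; norm_num
    unfold th
    rw [tsum_congr hterm]
    have hs : Summable (fun n : ℤ => q ^ (n ^ 2)) := by
      simpa [aa_abs q hq0] using aa_sum q hq0 hq1
    exact hs.tsum_pos (fun n => (zpow_pos hq0 _).le) 0 (zpow_pos hq0 _)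
  intro h0
  simp only [h0, zero_mul] at hconst
  have := mul_pos hpos (Real.exp_pos (-2 * E (Real.pi / 2)))
  linarith

lemma tsum_even (f : ℤ → ℝ) (hf : Summable f) (h : ∀ m, f (-m) = f m) :
    ∑' m, f m = f 0 + 2 * ∑' n : ℕ, f (n + 1) := by
  rw [tsum_int_eq_zero_add_two_mul_tsum_pnat h hf, nsmul_eq_mul,
    tsum_pnat_eq_tsum_succ (f := fun n : ℕ => f n)]
  push_cast
  rfl

lemma th_eq (q : ℝ) (hq0 : 0 < q) (hq1 : q < 1) (w : ℝ) :
    1 + 2 * ∑' n : ℕ, (-1) ^ (n + 1) * q ^ ((n + 1) ^ 2) * Real.cos (2 * ((n : ℝ) + 1) * w)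
      = th q w := by
  unfold th
  rw [tsum_even]
  · congr 1
    · simp [aa]
    · congr 1
      refine tsum_congr fun n => ?_
      unfold aa
      push_cast
      norm_cast
  · exact (norm_sum _ (aa_sum q hq0 hq1) _ (fun n => Real.abs_cos_le_one _)).of_norm
  · intro m
    rw [aa_neg]; push_cast
    rw [show 2 * -(m:ℝ) * w = -(2 * m * w) by ring, Real.cos_neg]

lemma sg_eq (q : ℝ) (hq0 : 0 < q) (hq1 : q < 1) (w : ℝ) :
    2 * ∑' n : ℕ, q ^ (n + 1) / (1 - q ^ (2 * (n + 1))) * Real.sin (2 * ((n : ℝ) + 1) * w)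
      = sg q w := by
  unfold sg
  rw [tsum_even]
  · rw [tt_zero, zero_mul, zero_add]
    congr 1
    refine tsum_congr fun n => ?_
    unfold tt
    push_cast
    norm_cast
  · exact (norm_sum _ (tt_sum q hq0 hq1) _ (fun n => Real.abs_sin_le_one _)).of_norm
  · intro m
    rw [tt_neg q hq0]; push_cast
    rw [show 2 * -(m:ℝ) * w = -(2 * m * w) by ring, Real.sin_neg]; ring


/-- For 0 < q < 1, with θ₄(z) = 1 + 2∑_{n≥1} (−1)^n q^{n²} cos(2nz),
θ₄'(z)/θ₄(z) = 4·∑_{n=1}^∞ (q^n/(1−q^{2n}))·sin(2nz) for all real z. -/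
theorem theta4_logDeriv (q : ℝ) (hq0 : 0 < q) (hq1 : q < 1) (z : ℝ) :
    deriv (fun w : ℝ => 1 + 2 * ∑' n : ℕ,
        (-1) ^ (n + 1) * q ^ ((n + 1) ^ 2) * Real.cos (2 * ((n : ℝ) + 1) * w)) z
      / (1 + 2 * ∑' n : ℕ,
        (-1) ^ (n + 1) * q ^ ((n + 1) ^ 2) * Real.cos (2 * ((n : ℝ) + 1) * z))
      = 4 * ∑' n : ℕ, q ^ (n + 1) / (1 - q ^ (2 * (n + 1)))
          * Real.sin (2 * ((n : ℝ) + 1) * z) := by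
  simp only [th_eq q hq0 hq1]
  have h := (th_deriv q hq0 hq1 z).deriv
  change deriv (th q) z / _ = _
  rw [h, mul_div_assoc, div_self (th_ne q hq0 hq1 z), ← sg_eq q hq0 hq1 z]
  ring
end

section
/- Define Φ_ν(q) = ∑_{n=1}^∞ n^ν q^n/(1−q^n) for |q| < 1, Q(q) = 1 + 240·Φ₃(q), and R(q) = 1 − 504·Φ₅(q). Then Φ₉(q) = (1 − Q(q)·R(q))/264. -/
/-- Lambert-type Eisenstein series Φ_ν(q) = ∑_{n=1}^∞ n^ν q^n/(1−q^n). -/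
noncomputable def Phi (ν : ℕ) (q : ℂ) : ℂ :=
  ∑' n : ℕ, ((n : ℂ) + 1) ^ ν * q ^ (n + 1) / (1 - q ^ (n + 1))

open UpperHalfPlane ModularForm ModularFormClass MatrixGroups EisensteinSeries in
/-- `E₁₀ = E₄ E₆`. -/
lemma E10_eq (z : ℍ) : E (k := 10) (by norm_num) z = E₄ z * E₆ z := by
  set f : ModularForm 𝒮ℒ ((10 : ℕ) : ℤ) :=
    E (k := 10) (by norm_num) - ModularForm.mcast (by norm_num) (E₄.mul E₆) with hf
  have h0 : f = 0 := by
    apply sturm_bound_levelOne_nat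
    rw [show (10 / 12 : ℕ) = 0 by norm_num, Nat.cast_zero, pos_iff_ne_zero,
      PowerSeries.order_ne_zero_iff_constCoeff_eq_zero, ← PowerSeries.coeff_zero_eq_constantCoeff_apply]
    simp [hf, FunLike.coe_sub, coe_mcast,
      ModularForm.qExpansion_sub one_pos one_mem_strictPeriods_SL,
      ModularForm.qExpansion_mul one_pos one_mem_strictPeriods_SL,
      PowerSeries.coeff_mul, -PowerSeries.coeff_zero_eq_constantCoeff,
      E_qExpansion_coeff_zero _ ⟨2, rfl⟩, E_qExpansion_coeff_zero _ ⟨3, rfl⟩,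
      E_qExpansion_coeff_zero (k := 10) _ ⟨5, rfl⟩]
  have h1 : f z = 0 := by rw [h0]; rfl
  have h2 : f z = E (k := 10) (by norm_num) z - E₄ z * E₆ z := rfl
  rw [h2] at h1
  exact sub_eq_zero.mp h1

open UpperHalfPlane ModularForm EisensteinSeries in
/-- Eisenstein series in terms of the Lambert series `Phi`. -/
lemma E_eq_Phi {k : ℕ} (hk : 3 ≤ k) (hk2 : Even k) (z : ℍ) (q : ℂ)
    (hz : Complex.exp (2 * Real.pi * Complex.I * z) = q) (hq : ‖q‖ < 1) :
    E hk z = 1 - (2 * k / bernoulli k) * Phi (k - 1) q := by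
  rw [q_expansion_bernoulli hk hk2, hz]
  simp_rw [zpow_natCast]
  rw [← tsum_pow_div_one_sub_eq_tsum_sigma hq,
    tsum_pnat_eq_tsum_succ (f := fun n : ℕ ↦ (n : ℂ) ^ (k - 1) * q ^ n / (1 - q ^ n))]
  simp [Phi]

/-- Values of the Bernoulli numbers used below. -/
lemma bernoulli_values :
    bernoulli 4 = -1 / 30 ∧ bernoulli 6 = 1 / 42 ∧ bernoulli 10 = 5 / 66 := by
  have h5 : bernoulli' 5 = 0 := bernoulli'_eq_zero_of_odd ⟨2, rfl⟩ (by norm_num)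
  have h7 : bernoulli' 7 = 0 := bernoulli'_eq_zero_of_odd ⟨3, rfl⟩ (by norm_num)
  have h9 : bernoulli' 9 = 0 := bernoulli'_eq_zero_of_odd ⟨4, rfl⟩ (by norm_num)
  have h6 : bernoulli' 6 = 1 / 42 := by
    rw [bernoulli'_def]
    norm_num [Finset.sum_range_succ, h5, Nat.choose]
  have h8 : bernoulli' 8 = -1 / 30 := by
    rw [bernoulli'_def]
    norm_num [Finset.sum_range_succ, h5, h6, h7, Nat.choose]
  have h10 : bernoulli' 10 = 5 / 66 := by
    rw [bernoulli'_def]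
    norm_num [Finset.sum_range_succ, h5, h6, h7, h8, h9, Nat.choose]
  refine ⟨?_, ?_, ?_⟩
  · rw [bernoulli_eq_bernoulli'_of_ne_one (by norm_num), bernoulli'_four]
  · rw [bernoulli_eq_bernoulli'_of_ne_one (by norm_num), h6]
  · rw [bernoulli_eq_bernoulli'_of_ne_one (by norm_num), h10]

/-- With Q = 1 + 240Φ₃ and R = 1 − 504Φ₅, Φ₉ = (1 − QR)/264 for |q| < 1. -/
theorem Phi9_eval (q : ℂ) (hq : ‖q‖ < 1) :
    Phi 9 q = (1 - (1 + 240 * Phi 3 q) * (1 - 504 * Phi 5 q)) / 264 := by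
  rcases eq_or_ne q 0 with rfl | h0
  · simp [Phi]
  let z : UpperHalfPlane := ⟨Function.Periodic.invQParam 1 q,
    Function.Periodic.im_invQParam_pos_of_norm_lt_one one_pos hq h0⟩
  have hz : Complex.exp (2 * Real.pi * Complex.I * z) = q := by
    have := Function.Periodic.qParam_right_inv (one_ne_zero (α := ℝ)) h0
    simpa [Function.Periodic.qParam] using this
  have h := E10_eq z
  rw [E_eq_Phi _ ⟨5, rfl⟩ z q hz hq, E_eq_Phi _ ⟨2, rfl⟩ z q hz hq,
    E_eq_Phi _ ⟨3, rfl⟩ z q hz hq, bernoulli_values.1, bernoulli_values.2.1,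
    bernoulli_values.2.2] at h
  norm_num at h
  linear_combination (-1 / 264) * h
end

section
/- Let S₃(m) = ∑_{α≡1 (mod 4)} q^{α²/8}·α^m (sum over all integers α ≡ 1 mod 4), η(τ) = q^{1/24}·∏_{n=1}^∞ (1−q^n) with q = e^{2πiτ}, Im τ > 0. Then S₃(1) = η(τ)³. -/
open Complex

namespace EtaCubed

/-- finite q-Pochhammer product -/
noncomputable def P (q : ℂ) (n : ℕ) : ℂ := ∏ i ∈ Finset.range n, (1 - q ^ (i + 1))

/-- reciprocal of P, extended by zero to negative indices -/
noncomputable def u (q : ℂ) (j : ℤ) : ℂ := if 0 ≤ j then (P q j.toNat)⁻¹ else 0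

/-- the signed theta terms -/
noncomputable def w (τ : ℂ) (k : ℤ) : ℂ := jacobiTheta₂_term k (τ / 2 + 1 / 2) τ

/-- the terms of the finite identity -/
noncomputable def a (τ q : ℂ) (n : ℕ) (k : ℤ) : ℂ := w τ k * u q (n + k) * u q (n - k)

lemma hasSum_congr_fun {f g : ℤ → ℂ} {s : ℂ} (h : HasSum f s) (e : ∀ k, g k = f k) :
    HasSum g s := by
  rwa [funext e]

lemma hasSum_even_odd {f : ℤ → ℂ} {x y : ℂ} (he : HasSum (fun k => f (2 * k)) x)
    (ho : HasSum (fun k => f (2 * k + 1)) y) : HasSum f (x + y) := by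
  have i1 : Function.Injective (fun k : ℤ => 2 * k) := fun a b h => by
    simp only at h; omega
  have i2 : Function.Injective (fun k : ℤ => 2 * k + 1) := fun a b h => by
    simp only at h; omega
  have he' := i1.hasSum_range_iff.mpr he
  have ho' := i2.hasSum_range_iff.mpr ho
  refine he'.add_isCompl ?_ ho'
  simpa using Int.isCompl_even_odd

lemma one_sub_ne {q : ℂ} (hq : ‖q‖ < 1) (i : ℕ) : 1 - q ^ (i + 1) ≠ 0 := by
  intro h
  have h1 : q ^ (i + 1) = 1 := (sub_eq_zero.mp h).symm
  have h2 : ‖q‖ ^ (i + 1) = 1 := by rw [← norm_pow, h1, norm_one]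
  have h3 : ‖q‖ ^ (i + 1) < 1 := pow_lt_one₀ (norm_nonneg _) hq (by omega)
  linarith

lemma P_ne {q : ℂ} (hq : ‖q‖ < 1) (n : ℕ) : P q n ≠ 0 :=
  Finset.prod_ne_zero_iff.mpr fun i _ => one_sub_ne hq i

lemma P_succ (q : ℂ) (n : ℕ) : P q (n + 1) = P q n * (1 - q ^ (n + 1)) := by
  simp [P, Finset.prod_range_succ]

lemma u_rec {q : ℂ} (hq : ‖q‖ < 1) (j : ℤ) : u q (j - 1) = (1 - q ^ j) * u q j := by
  rcases lt_trichotomy j 0 with h | h | h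
  · simp [u, show ¬ (0 ≤ j) by omega, show ¬ (1 ≤ j) by omega]
  · subst h; simp [u]
  · obtain ⟨m, rfl⟩ : ∃ m : ℕ, j = m + 1 := ⟨(j - 1).toNat, by omega⟩
    have e : (q : ℂ) ^ ((m : ℤ) + 1) = q ^ (m + 1) := by exact_mod_cast zpow_natCast q (m + 1)
    have e2 : ((m : ℤ) + 1).toNat = m + 1 := by omega
    have := one_sub_ne hq m
    have := P_ne hq m
    rw [u, u, if_pos (by omega), if_pos (by omega), e, e2, P_succ]
    simp
    field_simp

lemma w_succ (τ : ℂ) (k : ℤ) :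
    w τ (k + 1) = - cexp (2 * Real.pi * I * τ) ^ (k + 1) * w τ k := by
  rw [w, w, jacobiTheta₂_term, jacobiTheta₂_term, ← Complex.exp_int_mul,
    neg_mul, ← Complex.exp_add, ← neg_one_mul, ← Complex.exp_pi_mul_I, ← Complex.exp_add]
  congr 1
  push_cast
  ring

lemma a_rec (τ q : ℂ) (hq : ‖q‖ < 1) (e : q = cexp (2 * Real.pi * I * τ)) (n : ℕ) (k : ℤ) :
    (1 - q ^ (2 * n + 1)) * (1 - q ^ (2 * n + 2)) * a τ q (n + 1) k =
      (1 + q ^ (2 * n + 1)) * a τ q n k - q ^ (n + 1) * a τ q n (k - 1)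
        - q ^ n * a τ q n (k + 1) := by
  have q0 : q ≠ 0 := by rw [e]; exact Complex.exp_ne_zero _
  set U := u q (n + 1 + k) with hU
  set V := u q (n + 1 - k) with hV
  have h1 : u q (n + k) = (1 - q ^ (n + 1 + k : ℤ)) * U := by
    rw [hU, ← u_rec hq]; congr 1; ring
  have h2 : u q (n - k) = (1 - q ^ (n + 1 - k : ℤ)) * V := by
    rw [hV, ← u_rec hq]; congr 1; ring
  have h3 : u q (n + (k - 1)) = (1 - q ^ (n + k : ℤ)) * u q (n + k) := by
    rw [← u_rec hq]; congr 1; ring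
  have h4 : u q (n - (k + 1)) = (1 - q ^ (n - k : ℤ)) * u q (n - k) := by
    rw [← u_rec hq]; congr 1; ring
  have h5 : u q (n + (k + 1)) = U := by rw [hU]; congr 1; ring
  have h6 : u q (n - (k - 1)) = V := by rw [hV]; congr 1; ring
  have w1 := w_succ τ k
  have w2 := w_succ τ (k - 1)
  rw [← e] at w1 w2
  rw [sub_add_cancel] at w2
  have w3 : w τ (k - 1) = - (q ^ k)⁻¹ * w τ k := by
    rw [w2]
    have : q ^ k ≠ 0 := zpow_ne_zero _ q0
    field_simp
  simp only [a]
  push_cast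
  rw [← hU, ← hV, h5, h6, h3, h4, h1, h2, w1, w3]
  have hk : q ^ k ≠ 0 := zpow_ne_zero _ q0
  have hn : q ^ n ≠ 0 := pow_ne_zero _ q0
  have p1 : q ^ (2 * n + 1) = q ^ n * q ^ n * q := by ring
  have p2 : q ^ (2 * n + 2) = q ^ n * q ^ n * q * q := by ring
  rw [p1, p2]
  simp only [zpow_add₀ q0, zpow_sub₀ q0, zpow_natCast, zpow_one, pow_succ]
  generalize q ^ k = K at *
  generalize q ^ n = N at *
  field_simp
  ring

lemma a_zero (τ q : ℂ) (n : ℕ) (k : ℤ) (h : k ∉ Finset.Icc (-(n : ℤ)) n) : a τ q n k = 0 := by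
  rw [Finset.mem_Icc] at h
  by_cases h1 : 0 ≤ (n : ℤ) + k
  · have : ¬ (0 ≤ (n : ℤ) - k) := by omega
    simp only [a, u, if_neg this, mul_zero]
  · simp only [a, u, if_neg h1, mul_zero, zero_mul]

lemma summable_a (τ q : ℂ) (n : ℕ) : Summable (a τ q n) :=
  summable_of_ne_finset_zero (s := Finset.Icc (-(n : ℤ)) n) fun k hk => a_zero τ q n k hk

lemma summable_ka (τ q : ℂ) (n : ℕ) : Summable (fun k : ℤ => (k : ℂ) * a τ q n k) :=
  summable_of_ne_finset_zero (s := Finset.Icc (-(n : ℤ)) n) fun k hk => by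
    rw [a_zero τ q n k hk, mul_zero]

lemma C_rec (τ q : ℂ) (hq : ‖q‖ < 1) (e : q = cexp (2 * Real.pi * I * τ)) (n : ℕ) :
    (1 - q ^ (2 * n + 1)) * (1 - q ^ (2 * n + 2)) * ∑' k, a τ q (n + 1) k =
      (1 - q ^ n) * (1 - q ^ (n + 1)) * ∑' k, a τ q n k := by
  have s := (summable_a τ q n).hasSum
  have s1 := (Equiv.subRight (1 : ℤ)).hasSum_iff.mpr s
  have s2 := (Equiv.addRight (1 : ℤ)).hasSum_iff.mpr s
  have t := ((s.mul_left (1 + q ^ (2 * n + 1))).sub (s1.mul_left (q ^ (n + 1)))).sub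
    (s2.mul_left (q ^ n))
  have r := (summable_a τ q (n + 1)).hasSum.mul_left
    ((1 - q ^ (2 * n + 1)) * (1 - q ^ (2 * n + 2)))
  rw [funext (a_rec τ q hq e n)] at r
  rw [r.unique t]
  ring

lemma D_rec (τ q : ℂ) (hq : ‖q‖ < 1) (e : q = cexp (2 * Real.pi * I * τ)) (n : ℕ) :
    (1 - q ^ (2 * n + 1)) * (1 - q ^ (2 * n + 2)) * ∑' k : ℤ, (k : ℂ) * a τ q (n + 1) k =
      (1 - q ^ n) * (1 - q ^ (n + 1)) * (∑' k : ℤ, (k : ℂ) * a τ q n k)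
        + (q ^ n - q ^ (n + 1)) * ∑' k, a τ q n k := by
  have s := (summable_a τ q n).hasSum
  have s1 := (Equiv.subRight (1 : ℤ)).hasSum_iff.mpr s
  have s2 := (Equiv.addRight (1 : ℤ)).hasSum_iff.mpr s
  have d := (summable_ka τ q n).hasSum
  have d1 := (Equiv.subRight (1 : ℤ)).hasSum_iff.mpr d
  have d2 := (Equiv.addRight (1 : ℤ)).hasSum_iff.mpr d
  have t := ((d.mul_left (1 + q ^ (2 * n + 1))).sub ((d1.add s1).mul_left (q ^ (n + 1)))).sub
    ((d2.sub s2).mul_left (q ^ n))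
  have r := (summable_ka τ q (n + 1)).hasSum.mul_left
    ((1 - q ^ (2 * n + 1)) * (1 - q ^ (2 * n + 2)))
  have t' := hasSum_congr_fun t (g := fun k : ℤ => (1 - q ^ (2 * n + 1)) * (1 - q ^ (2 * n + 2)) *
      ((k : ℂ) * a τ q (n + 1) k)) fun k => by
    have := a_rec τ q hq e n k
    simp only [Function.comp, Equiv.subRight_apply, Equiv.coe_addRight]
    push_cast
    linear_combination (k : ℂ) * this
  rw [r.unique t']
  ring

lemma C_zero (τ q : ℂ) : ∑' k, a τ q 0 k = 1 := by
  rw [tsum_eq_single 0]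
  · simp [a, u, P, w, jacobiTheta₂_term]
  · intro k hk
    apply a_zero
    simpa using fun h => by omega

lemma D_zero (τ q : ℂ) : ∑' k : ℤ, (k : ℂ) * a τ q 0 k = 0 := by
  rw [tsum_eq_single 0]
  · simp
  · intro k hk
    rw [a_zero, mul_zero]
    simpa using fun h => by omega

lemma C_succ (τ q : ℂ) (hq : ‖q‖ < 1) (e : q = cexp (2 * Real.pi * I * τ)) (n : ℕ) :
    ∑' k, a τ q (n + 1) k = 0 := by
  have key : ∀ n, (∑' k, a τ q n k) * (1 - q ^ n) = 0 → ∑' k, a τ q (n + 1) k = 0 := by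
    intro n h
    have := C_rec τ q hq e n
    rw [show (1 - q ^ n) * (1 - q ^ (n + 1)) * ∑' k, a τ q n k =
      (1 - q ^ (n + 1)) * ((∑' k, a τ q n k) * (1 - q ^ n)) by ring, h, mul_zero] at this
    exact (mul_eq_zero.mp this).resolve_left
      (mul_ne_zero (one_sub_ne hq _) (one_sub_ne hq _))
  induction n with
  | zero => exact key 0 (by simp)
  | succ n ih => exact key _ (by rw [ih, zero_mul])

lemma D_succ (τ q : ℂ) (hq : ‖q‖ < 1) (e : q = cexp (2 * Real.pi * I * τ)) (n : ℕ) :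
    (∑' k : ℤ, (k : ℂ) * a τ q (n + 1) k) * P q (2 * (n + 1)) = P q n * P q (n + 1) := by
  induction n with
  | zero =>
    have := D_rec τ q hq e 0
    rw [C_zero, D_zero] at this
    simp [P, Finset.prod_range_succ] at this ⊢
    linear_combination this
  | succ n ih =>
    have := D_rec τ q hq e (n + 1)
    rw [C_succ τ q hq e] at this
    rw [show 2 * (n + 1 + 1) = 2 * (n + 1) + 1 + 1 by ring, P_succ, P_succ, P_succ q (n + 1)]
    linear_combination P q (2 * (n + 1)) * this + (1 - q ^ (n + 1)) * (1 - q ^ (n + 1 + 1)) * ih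
      - (1 - q ^ (n + 1 + 1)) * P q (n + 1) * P_succ q n

lemma main (τ : ℂ) (hτ : 0 < τ.im) (q : ℂ) (e : q = cexp (2 * Real.pi * I * τ)) (hq : ‖q‖ < 1) :
    HasSum (fun k : ℤ => (k : ℂ) * w τ k) ((∏' n : ℕ, (1 - q ^ (n + 1))) ^ 3) := by
  set L := ∏' n : ℕ, (1 - q ^ (n + 1)) with hL
  have hP : Filter.Tendsto (P q) Filter.atTop (nhds L) :=
    (ModularForm.multipliable_one_sub_pow hq).hasProd.tendsto_prod_nat
  have hL0 : L ≠ 0 := by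
    have := ModularForm.eta_tprod_ne_zero (z := τ) hτ
    simp only [ModularForm.eta_q_eq_pow, ← e] at this
    exact this
  have hI := hP.inv₀ hL0
  obtain ⟨B, hB⟩ : ∃ B, ∀ n, ‖(P q n)⁻¹‖ ≤ B := by
    obtain ⟨B, hB⟩ := hI.norm.bddAbove_range
    exact ⟨B, fun n => hB ⟨n, rfl⟩⟩
  have hB0 : 0 ≤ B := (norm_nonneg _).trans (hB 0)
  have hu : ∀ j, ‖u q j‖ ≤ B := by
    intro j
    rw [u]
    split_ifs
    · exact hB _
    · simpa using hB0
  have hs : Summable (fun k : ℤ => (k : ℂ) * w τ k) := by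
    have := (summable_jacobiTheta₂'_term_iff (τ / 2 + 1 / 2) τ).mpr hτ
    have h2 := this.mul_left (2 * Real.pi * I)⁻¹
    refine h2.congr fun k => ?_
    rw [jacobiTheta₂'_term, w]
    have := Complex.two_pi_I_ne_zero
    rw [mul_assoc (2 * (Real.pi : ℂ) * I), inv_mul_cancel_left₀ this]
  have hlim : Filter.Tendsto (fun n : ℕ => ∑' k : ℤ, (k : ℂ) * a τ q n k) Filter.atTop
      (nhds (∑' k : ℤ, (k : ℂ) * (w τ k * L⁻¹ * L⁻¹))) := by
    refine tendsto_tsum_of_dominated_convergence (bound := fun k : ℤ => ‖(k : ℂ) * w τ k‖ * (B * B))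
      (hs.norm.mul_right _) (fun k => ?_) (Filter.Eventually.of_forall fun n k => ?_)
    · have hlu : ∀ k : ℤ, Filter.Tendsto (fun n : ℕ => u q (n + k)) Filter.atTop (nhds L⁻¹) := by
        intro k
        have ht : Filter.Tendsto (fun n : ℕ => ((n : ℤ) + k).toNat) Filter.atTop Filter.atTop := by
          rw [Filter.tendsto_atTop]
          intro b
          filter_upwards [Filter.eventually_ge_atTop (b + k.natAbs)] with n hn
          omega
        refine (hI.comp ht).congr' ?_
        filter_upwards [Filter.eventually_ge_atTop k.natAbs] with n hn
        simp only [Function.comp, u]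
        rw [if_pos (by omega)]
      exact (((hlu k).const_mul (w τ k)).mul (hlu (-k))).const_mul _
    · rw [a, ← mul_assoc, ← mul_assoc, norm_mul, norm_mul _ (u q (n + k)), mul_assoc ‖_‖]
      gcongr
      · exact hu _
      · exact hu _
  have h2 : Filter.Tendsto (fun n : ℕ => ∑' k : ℤ, (k : ℂ) * a τ q (n + 1) k) Filter.atTop
      (nhds (L * L / L)) := by
    have t1 := hP.comp (Filter.tendsto_add_atTop_nat 1)
    have t2 : Filter.Tendsto (fun n : ℕ => P q (2 * (n + 1))) Filter.atTop (nhds L) :=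
      hP.comp (Filter.tendsto_atTop_mono (fun n => by simp only [id]; omega) Filter.tendsto_id)
    refine ((hP.mul t1).div t2 hL0).congr fun n => ?_
    simp only [Pi.div_apply, Function.comp]
    rw [div_eq_iff (P_ne hq _), D_succ τ q hq e n]
  have h3 := tendsto_nhds_unique (hlim.comp (Filter.tendsto_add_atTop_nat 1)) h2
  have h4 := hs.hasSum
  have h5 := (h4.mul_right (L⁻¹ * L⁻¹)).tsum_eq
  have h6 : (∑' k : ℤ, (k : ℂ) * w τ k) * (L⁻¹ * L⁻¹) = L * L / L := by
    rw [← h5, ← h3]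
    exact tsum_congr fun k => by ring
  have h7 : (∑' k : ℤ, (k : ℂ) * w τ k) = L ^ 3 := by
    field_simp at h6
    linear_combination h6
  rwa [h7] at h4

end EtaCubed

theorem S3_one_eq_eta_cubed (τ : ℂ) (hτ : 0 < τ.im) :
    (∑' m : ℤ, Complex.exp (2 * Real.pi * Complex.I * τ * ((4 * (m : ℂ) + 1) ^ 2 / 8))
        * (4 * (m : ℂ) + 1))
      = (Complex.exp (2 * Real.pi * Complex.I * τ / 24)
          * ∏' n : ℕ, (1 - Complex.exp (2 * Real.pi * Complex.I * τ) ^ (n + 1))) ^ 3 := by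
  have hq : ‖cexp (2 * Real.pi * I * τ)‖ < 1 := UpperHalfPlane.norm_exp_two_pi_I_lt_one ⟨τ, hτ⟩
  have h := EtaCubed.main τ hτ _ rfl hq
  have he := (h.summable.comp_injective (i := fun m : ℤ => 2 * m)
    (fun x y hxy => by simpa using hxy)).hasSum
  have ho := (h.summable.comp_injective (i := fun m : ℤ => -(2 * m + 1))
    (fun x y hxy => by simpa using hxy)).hasSum
  have ho' := (Equiv.subLeft (-1 : ℤ)).hasSum_iff.mpr ho
  have ho2 := EtaCubed.hasSum_congr_fun ho'
      (g := fun m : ℤ => ((2 * m + 1 : ℤ) : ℂ) * EtaCubed.w τ (2 * m + 1)) fun m => by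
    simp only [Function.comp, Equiv.subLeft_apply]
    rw [show -(2 * (-1 - m) + 1) = 2 * m + 1 by ring]
  have hsum := (EtaCubed.hasSum_even_odd (f := fun k : ℤ => (k : ℂ) * EtaCubed.w τ k) he ho2).unique h
  have hh := (he.add ho).mul_left (cexp (2 * Real.pi * I * τ / 8))
  rw [hsum] at hh
  rw [mul_pow, ← Complex.exp_nat_mul, show ((3 : ℕ) : ℂ) * (2 * Real.pi * I * τ / 24) =
    2 * Real.pi * I * τ / 8 by push_cast; ring, ← hh.tsum_eq]
  refine tsum_congr fun m => ?_
  have w1 : EtaCubed.w τ (2 * m) = cexp (2 * Real.pi * I * τ * (2 * m ^ 2 + m)) := by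
    have h0 : EtaCubed.w τ (2 * m) = cexp (2 * Real.pi * I * τ * (2 * m ^ 2 + m) +
        m * (2 * Real.pi * I)) := by
      rw [EtaCubed.w, jacobiTheta₂_term]
      congr 1
      push_cast
      ring
    rw [h0, Complex.exp_add, Complex.exp_int_mul_two_pi_mul_I, mul_one]
  have w2 : EtaCubed.w τ (-(2 * m + 1)) = - cexp (2 * Real.pi * I * τ * (2 * m ^ 2 + m)) := by
    have h0 : EtaCubed.w τ (-(2 * m + 1)) = cexp (2 * Real.pi * I * τ * (2 * m ^ 2 + m) +
        (-m - 1 : ℤ) * (2 * Real.pi * I) + Real.pi * I) := by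
      rw [EtaCubed.w, jacobiTheta₂_term]
      congr 1
      push_cast
      ring
    rw [h0, Complex.exp_add, Complex.exp_add, Complex.exp_int_mul_two_pi_mul_I,
      Complex.exp_pi_mul_I, mul_one, mul_neg_one]
  simp only [Function.comp, w1, w2]
  rw [show 2 * (Real.pi : ℂ) * I * τ * ((4 * (m : ℂ) + 1) ^ 2 / 8) = 2 * Real.pi * I * τ / 8 +
    2 * Real.pi * I * τ * (2 * m ^ 2 + m) by ring, Complex.exp_add]
  push_cast
  ring
end

section
/- With q = e^{2πiτ}, Im τ > 0, S₃(m) = ∑_{α≡1 (mod 4)} q^{α²/8}·α^m, η(τ) = q^{1/24}∏_{n≥1}(1−q^n), and P(q) = 1 − 24·∑_{n≥1} n·q^n/(1−q^n), we have S₃(3) = η(τ)³·P(q). -/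
open Complex

/-- finite q-Pochhammer -/
noncomputable def qP (q : ℂ) (n : ℕ) : ℂ := ∏ k ∈ Finset.range n, (1 - q ^ (k + 1))

/-- weighted Gaussian binomials -/
noncomputable def gC (q : ℂ) : ℕ → ℕ → ℂ
  | 0, 0 => 1
  | 0, _ + 1 => 0
  | _ + 1, 0 => 1
  | N + 1, k + 1 => gC q N (k + 1) + q ^ N * gC q N k

lemma gC_zero (q : ℂ) (N : ℕ) : gC q N 0 = 1 := by cases N <;> simp [gC]

lemma gC_gt (q : ℂ) (N : ℕ) : ∀ k, N < k → gC q N k = 0 := by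
  induction N with
  | zero => intro k hk; obtain ⟨k, rfl⟩ := Nat.exists_eq_succ_of_ne_zero hk.ne'; simp [gC]
  | succ N ih =>
    intro k hk
    obtain ⟨k, rfl⟩ := Nat.exists_eq_succ_of_ne_zero (by omega : k ≠ 0)
    simp only [gC]
    rw [ih _ (by omega), ih _ (by omega)]; simp

lemma qP_succ (q : ℂ) (n : ℕ) : qP q (n + 1) = qP q n * (1 - q ^ (n + 1)) := by
  simp [qP, Finset.prod_range_succ]

lemma prod_eq (q x : ℂ) (N : ℕ) :
    ∏ k ∈ Finset.range N, (1 + x * q ^ k) = ∑ k ∈ Finset.range (N + 1), gC q N k * x ^ k := by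
  induction N with
  | zero => simp [gC]
  | succ N ih =>
    rw [Finset.prod_range_succ, ih, Finset.sum_range_succ' _ (N + 1)]
    simp only [gC, add_mul, Finset.sum_add_distrib]
    have h := Finset.sum_range_succ' (fun k => gC q N k * x ^ k) (N + 1)
    rw [Finset.sum_range_succ, gC_gt q N (N + 1) (by omega), gC_zero] at h
    rw [mul_add, mul_one, Finset.sum_mul]
    have h2 : ∑ i ∈ Finset.range (N + 1), gC q N i * x ^ i * (x * q ^ N)
      = ∑ i ∈ Finset.range (N + 1), q ^ N * gC q N i * x ^ (i + 1) :=
      Finset.sum_congr rfl fun i _ => by ring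
    rw [h2]
    linear_combination h

lemma gC_eq (q : ℂ) (N : ℕ) : ∀ k l, k + l = N →
    gC q N k * (qP q k * qP q l) = q ^ (k.choose 2) * qP q N := by
  induction N with
  | zero =>
    intro k l h
    obtain ⟨rfl, rfl⟩ : k = 0 ∧ l = 0 := by omega
    simp [gC, qP]
  | succ N ih =>
    intro k l h
    cases k with
    | zero =>
      obtain rfl : l = N + 1 := by omega
      simp [gC, qP]
    | succ k =>
      simp only [gC]
      have e : (k + 1).choose 2 = k.choose 2 + k := by
        rw [Nat.choose_succ_succ' k 1]; simp; omega
      cases l with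
      | zero =>
        obtain rfl : k = N := by omega
        rw [gC_gt q k (k + 1) (by omega), qP_succ, e, pow_add]
        linear_combination q ^ k * (1 - q ^ (k + 1)) * ih k 0 (by omega)
      | succ l =>
        have h1 := ih (k + 1) l (by omega)
        have h2 := ih k (l + 1) (by omega)
        obtain rfl : N = k + 1 + l := by omega
        rw [e] at h1 ⊢
        rw [qP_succ] at h1 h2
        rw [qP_succ q (k + 1 + l), qP_succ, qP_succ]
        linear_combination (1 - q ^ (l + 1)) * h1 + q ^ (k + 1 + l) * (1 - q ^ (k + 1)) * h2

lemma qbinom_deriv (q : ℂ) (hq : q ≠ 0) (n : ℕ) :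
    ∑ k ∈ Finset.range (2 * n + 2), (k : ℂ) * gC q (2 * n + 1) k * (-(q ^ n)⁻¹) ^ k
      = -((-1) ^ n * (q ^ ((n + 1).choose 2))⁻¹ * qP q n ^ 2) := by
  set x₀ : ℂ := -(q ^ n)⁻¹ with hx₀
  have hqn : q ^ n ≠ 0 := pow_ne_zero _ hq
  have hx0 : x₀ ≠ 0 := by simp [hx₀, hq]
  let R : ℂ → ℂ := fun x => (∏ k ∈ Finset.range n, (1 + x * q ^ k)) *
      ∏ k ∈ Finset.range n, (1 + x * q ^ (n + 1 + k))
  have hR : R x₀ = (-1) ^ n * (q ^ ((n + 1).choose 2))⁻¹ * qP q n ^ 2 := by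
    have h1 : ∏ k ∈ Finset.range n, (1 + x₀ * q ^ (n + 1 + k)) = qP q n := by
      refine Finset.prod_congr rfl fun k _ => ?_
      rw [hx₀]; field_simp; ring
    have h2 : ∀ m ≤ n, ∏ k ∈ Finset.range n, (1 + x₀ * q ^ k) =
        ∏ k ∈ Finset.range n, (-1 * (q ^ (k + 1))⁻¹ * (1 - q ^ (k + 1))) := by
      intro m _
      rw [← Finset.prod_range_reflect]
      refine Finset.prod_congr rfl fun k hk => ?_
      have hk := Finset.mem_range.1 hk
      obtain ⟨d, rfl⟩ : ∃ d, n = d + k + 1 := ⟨n - 1 - k, by omega⟩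
      rw [show d + k + 1 - 1 - k = d by omega, hx₀]
      field_simp
      ring
    have h3 : ∏ k ∈ Finset.range n, q ^ (k + 1) = q ^ ((n + 1).choose 2) := by
      have : ∀ m : ℕ, ∏ k ∈ Finset.range m, q ^ (k + 1) = q ^ ((m + 1).choose 2) := by
        intro m
        induction m with
        | zero => simp
        | succ m ih =>
          rw [Finset.prod_range_succ, ih, Nat.choose_succ_succ' (m + 1) 1, ← pow_add]
          simp [add_comm]
      exact this n
    simp only [R]
    rw [h1, h2 n le_rfl, Finset.prod_mul_distrib, Finset.prod_mul_distrib, Finset.prod_inv_distrib,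
      h3]
    simp [qP]; ring
  have hfac : ∀ x, ∑ k ∈ Finset.range (2 * n + 2), gC q (2 * n + 1) k * x ^ k
      = (1 + x * q ^ n) * R x := by
    intro x
    rw [← prod_eq, show 2 * n + 1 = n + 1 + n by ring, Finset.prod_range_add, Finset.prod_range_succ]
    simp only [R]; ring
  have hd1 : HasDerivAt (fun x => ∑ k ∈ Finset.range (2 * n + 2), gC q (2 * n + 1) k * x ^ k)
      (∑ k ∈ Finset.range (2 * n + 2), gC q (2 * n + 1) k * (k * x₀ ^ (k - 1))) x₀ :=
    HasDerivAt.fun_sum fun k _ => (hasDerivAt_pow k x₀).const_mul _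
  have hRd : DifferentiableAt ℂ R x₀ := by
    simp only [R]
    fun_prop
  have hd2 : HasDerivAt (fun x => (1 + x * q ^ n) * R x)
     ((1 * q ^ n) * R x₀ + (1 + x₀ * q ^ n) * deriv R x₀) x₀ :=
    HasDerivAt.mul (((hasDerivAt_id x₀).mul_const _).const_add 1) hRd.hasDerivAt
  have h := hd1.unique (by simpa only [hfac] using hd2)
  have hz : x₀ * q ^ n = -1 := by rw [hx₀]; field_simp
  rw [← hR]
  have h4 : ∑ k ∈ Finset.range (2 * n + 2), (k : ℂ) * gC q (2 * n + 1) k * x₀ ^ k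
     = x₀ * ∑ k ∈ Finset.range (2 * n + 2), gC q (2 * n + 1) k * (k * x₀ ^ (k - 1)) := by
    rw [Finset.mul_sum]
    refine Finset.sum_congr rfl fun k _ => ?_
    cases k with
    | zero => simp
    | succ k => simp; ring
  rw [h4, h, hz]
  linear_combination R x₀ * hz

lemma finite_jac (q : ℂ) (hq : q ≠ 0) (hP : ∀ n, qP q n ≠ 0) (n : ℕ) :
    ∑ j ∈ Finset.range (n + 1), (-1) ^ j * (2 * (j : ℂ) + 1) * q ^ ((j + 1).choose 2) *
      (qP q (2 * n + 1) * (qP q (n - j))⁻¹ * (qP q (n + 1 + j))⁻¹) = qP q n ^ 2 := by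
  have h := qbinom_deriv q hq n
  rw [show 2 * n + 2 = (n + 1) + (n + 1) by ring, Finset.sum_range_add,
    ← Finset.sum_range_reflect, ← Finset.sum_add_distrib] at h
  have hc : q ^ ((n + 1).choose 2) ≠ 0 := pow_ne_zero _ hq
  have hs : ((-1 : ℂ) ^ n) * (-1) ^ n = 1 := by rw [← mul_pow]; simp
  have h' : qP q n ^ 2 = -((-1) ^ n * q ^ ((n + 1).choose 2)) *
     -((-1) ^ n * (q ^ ((n + 1).choose 2))⁻¹ * qP q n ^ 2) := by
    field_simp
    linear_combination (-qP q n ^ 2) * hs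
  rw [h', ← h, Finset.mul_sum]
  refine Finset.sum_congr rfl fun j hj => ?_
  have hj := Finset.mem_range.1 hj
  obtain ⟨d, rfl⟩ : ∃ d, n = d + j := ⟨n - j, by omega⟩
  have e1 := gC_eq q (2 * (d + j) + 1) d (d + j + 1 + j) (by ring)
  have e2 := gC_eq q (2 * (d + j) + 1) (d + j + 1 + j) d (by ring)
  rw [show d + j + 1 - 1 - j = d by omega, show d + j - j = d by omega]
  have f1 : gC q (2 * (d + j) + 1) d = q ^ (d.choose 2) * qP q (2 * (d + j) + 1) *
      (qP q d)⁻¹ * (qP q (d + j + 1 + j))⁻¹ := by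
    have := hP d; have := hP (d + j + 1 + j)
    field_simp; linear_combination e1
  have f2 : gC q (2 * (d + j) + 1) (d + j + 1 + j) = q ^ ((d + j + 1 + j).choose 2) *
      qP q (2 * (d + j) + 1) * (qP q d)⁻¹ * (qP q (d + j + 1 + j))⁻¹ := by
    have := hP d; have := hP (d + j + 1 + j)
    field_simp; linear_combination e2
  have c2 : ∀ m : ℕ, ((m + 1).choose 2) * 2 = m * (m + 1) := fun m => by
    rw [Nat.choose_two_right, Nat.div_mul_cancel]
    · simp; ring
    · simpa [mul_comm] using (Nat.even_mul_succ_self m).two_dvd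
  have c2' : (d.choose 2) * 2 + d = d * d := by
    cases d with
    | zero => simp
    | succ d => rw [c2]; ring
  have g1 : q ^ ((d + j + 1).choose 2) * q ^ (d.choose 2) =
      q ^ ((j + 1).choose 2) * (q ^ (d + j)) ^ d := by
    rw [← pow_mul, ← pow_add, ← pow_add]
    congr 1
    have := c2 (d + j); have := c2 j
    nlinarith
  have g2 : q ^ ((d + j + 1).choose 2) * q ^ ((d + j + 1 + j).choose 2) =
      q ^ ((j + 1).choose 2) * (q ^ (d + j)) ^ (d + j + 1 + j) := by
    rw [← pow_mul, ← pow_add, ← pow_add]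
    congr 1
    have := c2 (d + j); have := c2 j
    have := c2 (d + j + j)
    rw [show d + j + j + 1 = d + j + 1 + j by ring] at this
    nlinarith
  rw [f1, f2]
  have hqd : q ^ (d + j) ≠ 0 := pow_ne_zero _ hq
  have k1 : q ^ ((d + j + 1).choose 2) * q ^ (d.choose 2) * (-(q ^ (d + j))⁻¹) ^ d
      = (-1) ^ d * q ^ ((j + 1).choose 2) := by
    rw [g1, neg_pow, inv_pow]; field_simp
  have k2 : q ^ ((d + j + 1).choose 2) * q ^ ((d + j + 1 + j).choose 2) *
      (-(q ^ (d + j))⁻¹) ^ (d + j + 1 + j) = -(-1) ^ d * q ^ ((j + 1).choose 2) := by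
    have : ((-1 : ℂ)) ^ (d + j + 1 + j) = -(-1) ^ d := by
      rw [show d + j + 1 + j = d + 1 + 2 * j by ring, pow_add, pow_mul]; simp [pow_succ]
    rw [g2, neg_pow, inv_pow, this]; field_simp
  have hsd : ((-1 : ℂ) ^ d) * (-1) ^ d = 1 := by rw [← mul_pow]; simp
  set A := qP q (2 * (d + j) + 1)
  set B := (qP q d)⁻¹
  set C := (qP q (d + j + 1 + j))⁻¹
  push_cast
  rw [pow_add]
  linear_combination (-1) ^ d * (-1) ^ j * A * B * C * (d * k1 + (d + j + 1 + j) * k2)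
    - (-1) ^ j * (2 * j + 1) * q ^ ((j + 1).choose 2) * A * B * C * hsd

open Filter Topology in
lemma jac (q : ℂ) (hq : q ≠ 0) (hq1 : ‖q‖ < 1) :
    (Summable fun j : ℕ => (-1 : ℂ) ^ j * (2 * (j : ℂ) + 1) * q ^ ((j + 1).choose 2)) ∧
    (∏' n : ℕ, (1 - q ^ (n + 1))) ^ 3 =
      ∑' j : ℕ, (-1 : ℂ) ^ j * (2 * (j : ℂ) + 1) * q ^ ((j + 1).choose 2) := by
  have hne : ∀ n : ℕ, 1 - q ^ (n + 1) ≠ 0 := by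
    intro n h
    have : ‖q ^ (n + 1)‖ < 1 := by
      rw [norm_pow]; exact pow_lt_one₀ (norm_nonneg _) hq1 (by omega)
    rw [← sub_eq_zero.1 h] at this
    simp at this
  have hP : ∀ n, qP q n ≠ 0 := fun n => Finset.prod_ne_zero_iff.2 fun k _ => hne k
  set L := ∏' n : ℕ, (1 - q ^ (n + 1)) with hL
  have hT : Tendsto (qP q) atTop (𝓝 L) :=
    (ModularForm.multipliable_one_sub_pow hq1).hasProd.tendsto_prod_nat
  have hL0 : L ≠ 0 := by
    have := tprod_one_add_ne_zero_of_summable (f := fun n : ℕ => -q ^ (n + 1))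
      (fun n => by simpa [sub_eq_add_neg] using hne n)
      (by simpa using (summable_nat_add_iff 1).mpr
            (summable_geometric_of_lt_one (norm_nonneg _) hq1))
    simpa [hL, sub_eq_add_neg] using this
  have hTi : Tendsto (fun n => (qP q n)⁻¹) atTop (𝓝 L⁻¹) := hT.inv₀ hL0
  obtain ⟨C, hC⟩ := hT.norm.bddAbove_range
  obtain ⟨D, hD⟩ := hTi.norm.bddAbove_range
  have hC : ∀ n, ‖qP q n‖ ≤ C := fun n => hC ⟨n, rfl⟩
  have hD : ∀ n, ‖(qP q n)⁻¹‖ ≤ D := fun n => hD ⟨n, rfl⟩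
  have hC0 : 0 ≤ C := (norm_nonneg _).trans (hC 0)
  have hD0 : 0 ≤ D := (norm_nonneg _).trans (hD 0)
  have hs : Summable fun j : ℕ => (2 * (j : ℝ) + 1) * ‖q‖ ^ j := by
    have h1 := summable_pow_mul_geometric_of_norm_lt_one (R := ℝ) 1 (r := ‖q‖) (by simpa using hq1)
    have h2 := summable_geometric_of_lt_one (norm_nonneg _) hq1
    refine ((h1.mul_left 2).add h2).congr fun j => ?_
    ring
  have hb : ∀ j : ℕ, ‖(-1 : ℂ) ^ j * (2 * (j : ℂ) + 1) * q ^ ((j + 1).choose 2)‖ ≤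
      (2 * (j : ℝ) + 1) * ‖q‖ ^ j := by
    intro j
    have h1 : ‖(2 * (j : ℂ) + 1)‖ = 2 * (j : ℝ) + 1 := by
      have := Complex.norm_natCast (2 * j + 1)
      push_cast at this
      exact this
    rw [norm_mul, norm_mul, norm_pow, norm_pow, h1]
    simp only [norm_neg, norm_one, one_pow, one_mul]
    gcongr 1
    apply pow_le_pow_of_le_one (norm_nonneg _) hq1.le
    rw [Nat.choose_succ_succ' j 1]; simp
  refine ⟨Summable.of_norm_bounded hs hb, ?_⟩
  have key := tendsto_tsum_of_dominated_convergence (𝓕 := atTop)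
    (f := fun n j : ℕ => if j < n + 1 then
      (-1 : ℂ) ^ j * (2 * (j : ℂ) + 1) * q ^ ((j + 1).choose 2) *
      (qP q (2 * n + 1) * (qP q (n - j))⁻¹ * (qP q (n + 1 + j))⁻¹) else 0)
    (g := fun j : ℕ => (-1 : ℂ) ^ j * (2 * (j : ℂ) + 1) * q ^ ((j + 1).choose 2) *
      (L * L⁻¹ * L⁻¹))
    (bound := fun j => (2 * (j : ℝ) + 1) * ‖q‖ ^ j * (C * D * D))
    (hs.mul_right _) ?_ ?_
  · have e : ∀ n : ℕ, (∑' j : ℕ, if j < n + 1 then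
      (-1 : ℂ) ^ j * (2 * (j : ℂ) + 1) * q ^ ((j + 1).choose 2) *
      (qP q (2 * n + 1) * (qP q (n - j))⁻¹ * (qP q (n + 1 + j))⁻¹) else 0) = qP q n ^ 2 := by
      intro n
      rw [← finite_jac q hq hP n, tsum_eq_sum (s := Finset.range (n + 1))]
      · exact Finset.sum_congr rfl fun j hj => if_pos (Finset.mem_range.1 hj)
      · intro j hj
        exact if_neg (by simpa using hj)
    simp only [e] at key
    have h := tendsto_nhds_unique key (hT.pow 2)
    rw [tsum_mul_right] at h
    field_simp at h
    linear_combination -h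
  · intro j
    have h1 : Tendsto (fun n : ℕ => qP q (2 * n + 1)) atTop (𝓝 L) :=
      hT.comp (tendsto_atTop_mono (fun n => by simp only [id]; omega) tendsto_id)
    have h2 : Tendsto (fun n : ℕ => (qP q (n - j))⁻¹) atTop (𝓝 L⁻¹) :=
      hTi.comp (tendsto_sub_atTop_nat j)
    have h3 : Tendsto (fun n : ℕ => (qP q (n + 1 + j))⁻¹) atTop (𝓝 L⁻¹) :=
      hTi.comp (tendsto_atTop_mono (fun n => by simp only [id]; omega) tendsto_id)
    refine (((h1.mul h2).mul h3).const_mul _).congr' ?_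
    filter_upwards [eventually_ge_atTop j] with n hn
    rw [if_pos (by omega)]
  · refine Eventually.of_forall fun n j => ?_
    split_ifs
    · rw [norm_mul]
      refine mul_le_mul (hb j) ?_ (norm_nonneg _) (by positivity)
      rw [norm_mul, norm_mul]
      gcongr
      · exact hC _
      · exact hD _
      · exact hD _
    · simp; positivity

lemma jac_int (τ : ℂ) (hτ : 0 < τ.im) :
    (∑' m : ℤ, Complex.exp (2 * Real.pi * Complex.I * τ * ((4 * (m : ℂ) + 1) ^ 2 / 8))
        * (4 * (m : ℂ) + 1)) = ModularForm.eta τ ^ 3 := by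
  set q := Complex.exp (2 * Real.pi * Complex.I * τ) with hqdef
  have hq1 : ‖q‖ < 1 := by simpa using UpperHalfPlane.norm_exp_two_pi_I_lt_one ⟨τ, hτ⟩
  obtain ⟨hs, h⟩ := jac q (Complex.exp_ne_zero _) hq1
  set f : ℕ → ℂ := fun j => (-1 : ℂ) ^ j * (2 * (j : ℂ) + 1) * q ^ ((j + 1).choose 2) with hf
  set g : ℤ → ℂ := fun m => Complex.exp (2 * Real.pi * Complex.I * τ * ((4 * (m : ℂ) + 1) ^ 2 / 8))
        * (4 * (m : ℂ) + 1) with hg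
  set c := Complex.exp (2 * Real.pi * Complex.I * τ / 8) with hc
  have hs0 : Summable fun k : ℕ => f (2 * k) :=
    hs.comp_injective fun a b h => by simpa using h
  have hs1 : Summable fun k : ℕ => f (2 * k + 1) :=
    hs.comp_injective fun a b h => by simpa using h
  have c2 : ∀ m : ℕ, (((m + 1).choose 2 : ℕ) : ℂ) = (m : ℂ) * (m + 1) / 2 := fun m => by
    rw [Nat.cast_choose_two]; push_cast; ring
  have e0 : ∀ k : ℕ, g (k : ℤ) = c * f (2 * k) := by
    intro k
    simp only [hg, hf, hc, hqdef, ← Complex.exp_nat_mul, c2]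
    rw [pow_mul]
    push_cast
    rw [show (2 * (Real.pi : ℂ) * I * τ * ((4 * (k : ℂ) + 1) ^ 2 / 8)) = 2 * Real.pi * I * τ / 8 +
      (2 * (k : ℂ) * (2 * k + 1) / 2 * (2 * Real.pi * I * τ)) by ring, Complex.exp_add]
    simp; ring
  have e1 : ∀ k : ℕ, g (-((k : ℤ) + 1)) = c * f (2 * k + 1) := by
    intro k
    simp only [hg, hf, hc, hqdef, ← Complex.exp_nat_mul, c2]
    rw [pow_succ (-1 : ℂ), pow_mul]
    push_cast
    rw [show (2 * (Real.pi : ℂ) * I * τ * ((4 * -((k : ℂ) + 1) + 1) ^ 2 / 8)) = 2 * Real.pi * I * τ / 8 +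
      ((2 * (k : ℂ) + 1) * (2 * k + 1 + 1) / 2 * (2 * Real.pi * I * τ)) by ring, Complex.exp_add]
    simp; ring
  change ∑' m, g m = _
  rw [tsum_of_nat_of_neg_add_one (f := g) (by simpa only [e0] using hs0.mul_left c)
    (by simpa only [e1] using hs1.mul_left c)]
  simp only [e0, e1]
  rw [tsum_mul_left, tsum_mul_left, ← mul_add, tsum_even_add_odd hs0 hs1, ← h, ModularForm.eta,
    mul_pow]
  simp only [ModularForm.eta_q_eq_pow]
  congr 1
  rw [Function.Periodic.qParam, ← Complex.exp_nat_mul, hc]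
  congr 1
  push_cast
  ring

lemma logDeriv_eta' (z : ℂ) (hz : 0 < z.im) : logDeriv ModularForm.eta z =
    (Real.pi * I / 12) * (1 - 24 * ∑' n : ℕ, ((n : ℂ) + 1)
            * Complex.exp (2 * Real.pi * Complex.I * z) ^ (n + 1)
            / (1 - Complex.exp (2 * Real.pi * Complex.I * z) ^ (n + 1))) := by
  have hz' : z ∈ UpperHalfPlane.upperHalfPlaneSet := hz
  unfold ModularForm.eta
  rw [logDeriv_mul _ (Function.Periodic.qParam_ne_zero _) (ModularForm.eta_tprod_ne_zero hz')
    (by fun_prop) (ModularForm.differentiableAt_eta_tprod hz')]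
  have HG := logDeriv_tprod_eq_tsum UpperHalfPlane.isOpen_upperHalfPlaneSet hz'
    (ModularForm.one_sub_eta_q_ne_zero · hz') (by fun_prop)
    (ModularForm.summable_logDeriv_one_sub_eta_q hz')
    ModularForm.multipliableLocallyUniformlyOn_eta (ModularForm.eta_tprod_ne_zero hz')
  rw [ModularForm.logDeriv_qParam 24 z, HG, ModularForm.tsum_logDeriv_eta_q z]
  simp only [ModularForm.eta_q_eq_pow, mul_neg, neg_div, tsum_neg]
  push_cast
  ring

theorem S3_three_eq (τ : ℂ) (hτ : 0 < τ.im) :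
    (∑' m : ℤ, Complex.exp (2 * Real.pi * Complex.I * τ * ((4 * (m : ℂ) + 1) ^ 2 / 8))
        * (4 * (m : ℂ) + 1) ^ 3)
      = (Complex.exp (2 * Real.pi * Complex.I * τ / 24)
          * ∏' n : ℕ, (1 - Complex.exp (2 * Real.pi * Complex.I * τ) ^ (n + 1))) ^ 3
        * (1 - 24 * ∑' n : ℕ, ((n : ℂ) + 1)
            * Complex.exp (2 * Real.pi * Complex.I * τ) ^ (n + 1)
            / (1 - Complex.exp (2 * Real.pi * Complex.I * τ) ^ (n + 1))) := by
  have hη : Complex.exp (2 * Real.pi * Complex.I * τ / 24)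
      * ∏' n : ℕ, (1 - Complex.exp (2 * Real.pi * Complex.I * τ) ^ (n + 1)) = ModularForm.eta τ := by
    simp only [ModularForm.eta, ModularForm.eta_q_eq_pow, Function.Periodic.qParam]
    norm_num
  rw [hη]
  set U : Set ℂ := {z | τ.im / 2 < z.im} with hU
  have hUo : IsOpen U := isOpen_lt continuous_const Complex.continuous_im
  have hτU : τ ∈ U := by change τ.im / 2 < τ.im; linarith
  set r : ℝ := Real.exp (-(Real.pi * τ.im / 8)) with hr
  have hr0 : 0 < r := Real.exp_pos _
  have hr1 : r < 1 := by
    rw [hr, Real.exp_lt_one_iff]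
    have := Real.pi_pos
    have : 0 < Real.pi * τ.im := by positivity
    linarith
  have hu : Summable fun m : ℤ => (4 * (m.natAbs : ℝ) + 1) * r ^ m.natAbs := by
    have hs : Summable fun j : ℕ => (4 * (j : ℝ) + 1) * r ^ j := by
      have h1 := summable_pow_mul_geometric_of_norm_lt_one (R := ℝ) 1 (r := r)
        (by rwa [Real.norm_of_nonneg hr0.le])
      have h2 := summable_geometric_of_lt_one hr0.le hr1
      refine ((h1.mul_left 4).add h2).congr fun j => ?_
      ring
    apply Summable.of_nat_of_neg
    · simpa using hs
    · simpa using hs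
  have hd : ∀ (m : ℤ) (z : ℂ), HasDerivAt (fun z : ℂ =>
      Complex.exp (2 * Real.pi * Complex.I * z * ((4 * (m : ℂ) + 1) ^ 2 / 8)) * (4 * (m : ℂ) + 1))
      (Real.pi * I / 4 * (Complex.exp (2 * Real.pi * Complex.I * z * ((4 * (m : ℂ) + 1) ^ 2 / 8))
        * (4 * (m : ℂ) + 1) ^ 3)) z := by
    intro m z
    have h1 : HasDerivAt (fun z : ℂ => 2 * Real.pi * Complex.I * z * ((4 * (m : ℂ) + 1) ^ 2 / 8))
      (2 * Real.pi * Complex.I * 1 * ((4 * (m : ℂ) + 1) ^ 2 / 8)) z :=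
      ((hasDerivAt_id z).const_mul _).mul_const _
    convert! h1.cexp.mul_const (4 * (m : ℂ) + 1) using 1
    ring
  have hsum := hasSum_deriv_of_summable_norm (U := U) (z := τ) hu
    (F := fun (m : ℤ) (z : ℂ) =>
      Complex.exp (2 * Real.pi * Complex.I * z * ((4 * (m : ℂ) + 1) ^ 2 / 8)) * (4 * (m : ℂ) + 1))
    (fun m z _ => (hd m z).differentiableAt.differentiableWithinAt) hUo ?_ hτU
  · simp only [fun m => (hd m τ).deriv] at hsum
    have h1 := hsum.tsum_eq
    rw [tsum_mul_left] at h1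
    have hev : (fun w : ℂ => ∑' m : ℤ, Complex.exp (2 * Real.pi * Complex.I * w *
        ((4 * (m : ℂ) + 1) ^ 2 / 8)) * (4 * (m : ℂ) + 1)) =ᶠ[nhds τ]
        fun w => ModularForm.eta w ^ 3 := by
      filter_upwards [hUo.mem_nhds hτU] with w hw
      exact jac_int w (lt_trans (by positivity) hw)
    rw [hev.deriv_eq] at h1
    have hηd := (ModularForm.differentiableAt_eta_of_mem_upperHalfPlaneSet
      (z := τ) hτ).hasDerivAt
    have hη0 := ModularForm.eta_ne_zero (z := τ) hτ
    have hld := logDeriv_eta' τ hτ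
    rw [logDeriv_apply, div_eq_iff hη0] at hld
    rw [(hηd.fun_pow 3).deriv, hld] at h1
    have hpi : (Real.pi : ℂ) * I / 4 ≠ 0 := by simp [Real.pi_ne_zero]
    apply mul_left_cancel₀ hpi
    rw [h1]
    push_cast
    ring
  · intro m w hw
    have hw : τ.im / 2 < w.im := hw
    have hcast : (4 * (m : ℂ) + 1) = ((4 * (m : ℝ) + 1 : ℝ) : ℂ) := by push_cast; rfl
    rw [norm_mul, mul_comm]
    have hm : |(m : ℝ)| = m.natAbs := by rw [Nat.cast_natAbs]; simp
    refine mul_le_mul ?_ ?_ (norm_nonneg _) (by positivity)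
    · rw [hcast, Complex.norm_real, Real.norm_eq_abs, ← hm]
      calc |4 * (m : ℝ) + 1| ≤ |4 * (m : ℝ)| + |1| := abs_add_le _ _
        _ = _ := by rw [abs_mul]; norm_num
    · rw [Complex.norm_exp, hr, ← Real.exp_nat_mul, Real.exp_le_exp]
      have hre : (2 * (Real.pi : ℂ) * I * w * ((4 * (m : ℂ) + 1) ^ 2 / 8)).re =
          -(2 * Real.pi * w.im * ((4 * (m : ℝ) + 1) ^ 2 / 8)) := by
        rw [show (2 * (Real.pi : ℂ) * I * w * ((4 * (m : ℂ) + 1) ^ 2 / 8)) =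
          ((2 * Real.pi * ((4 * (m : ℝ) + 1) ^ 2 / 8) : ℝ) : ℂ) * (I * w) by push_cast; ring,
          Complex.re_ofReal_mul]
        simp; ring
      rw [hre]
      have hsq : (m.natAbs : ℝ) ≤ (4 * (m : ℝ) + 1) ^ 2 := by
        have : (m.natAbs : ℤ) ≤ (4 * m + 1) ^ 2 := by
          rcases Int.natAbs_eq m with h | h
          · nlinarith [Int.natCast_nonneg m.natAbs]
          · nlinarith [Int.natCast_nonneg m.natAbs, sq_nonneg (4 * m + 1),
              Int.le_self_sq (m.natAbs : ℤ)]
        rw [← hm]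
        rw [Int.natCast_natAbs] at this
        exact_mod_cast this
      have hA : Real.pi * τ.im / 8 * (m.natAbs : ℝ) ≤ Real.pi * τ.im / 8 * (4 * (m : ℝ) + 1) ^ 2 := by
        gcongr
      have hB : Real.pi * (τ.im / 2) * ((4 * (m : ℝ) + 1) ^ 2 / 4) ≤
          Real.pi * w.im * ((4 * (m : ℝ) + 1) ^ 2 / 4) := by
        gcongr
      linarith
end

section
/- With q = e^{2πiτ}, Im τ > 0, S₃(m) = ∑_{α≡1 (mod 4)} q^{α²/8}·α^m, η(τ) = q^{1/24}∏_{n≥1}(1−q^n), P(q) = 1 − 24·Φ₁(q), and Q(q) = 1 + 240·Φ₃(q) where Φ_ν(q) = ∑_{n≥1} n^ν q^n/(1−q^n), we have S₃(5) = η(τ)³·(5·P(q)² − 2·Q(q))/3. -/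
open Complex

namespace S3Proof

open Filter Topology

/-- finite q-factorial -/
noncomputable def qf (q : ℂ) (n : ℕ) : ℂ := ∏ i ∈ Finset.range n, (1 - q ^ (i + 1))

/-- reciprocal q-factorial on the integers, zero at negative integers -/
noncomputable def w (q : ℂ) (k : ℤ) : ℂ := if 0 ≤ k then (qf q k.toNat)⁻¹ else 0

lemma qf_succ (q : ℂ) (n : ℕ) : qf q (n + 1) = qf q n * (1 - q ^ (n + 1)) := by
  simp [qf, Finset.prod_range_succ]

lemma one_sub_ne {q : ℂ} (hq : ‖q‖ < 1) (n : ℕ) : 1 - q ^ (n + 1) ≠ 0 := by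
  intro h
  have h1 : q ^ (n + 1) = 1 := by linear_combination -h
  have h2 : ‖q‖ ^ (n + 1) < 1 := pow_lt_one₀ (norm_nonneg _) hq (by omega)
  rw [← norm_pow, h1] at h2
  simp at h2

lemma qf_ne {q : ℂ} (hq : ‖q‖ < 1) (n : ℕ) : qf q n ≠ 0 :=
  Finset.prod_ne_zero_iff.mpr fun i _ => one_sub_ne hq i

lemma w_natCast (q : ℂ) (n : ℕ) : w q n = (qf q n)⁻¹ := by simp [w]

lemma w_neg (q : ℂ) {k : ℤ} (hk : k < 0) : w q k = 0 := by simp [w, hk]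

lemma w_pred {q : ℂ} (hq : ‖q‖ < 1) (k : ℤ) : w q (k - 1) = (1 - q ^ k) * w q k := by
  rcases lt_trichotomy k 0 with h | h | h
  · rw [w_neg q h, w_neg q (by omega), mul_zero]
  · subst h; rw [w_neg q (by omega)]; simp
  · obtain ⟨n, rfl⟩ : ∃ n : ℕ, k = (n + 1 : ℕ) := ⟨(k - 1).toNat, by omega⟩
    rw [show ((n + 1 : ℕ) : ℤ) - 1 = (n : ℕ) by push_cast; ring, w_natCast, w_natCast, qf_succ,
      zpow_natCast]
    have := qf_ne hq n
    have := one_sub_ne hq n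
    field_simp

/-- theta coefficient -/
noncomputable def g (τ : ℂ) (j : ℤ) : ℂ :=
  (-1) ^ j * Complex.exp (Real.pi * I * τ * (j * (j + 1)))

noncomputable def b (τ q : ℂ) (n : ℕ) (j : ℤ) : ℂ :=
  qf q (2 * n + 1) * g τ j * (w q (n - j) * w q (n + j + 1))

lemma g_succ {τ q : ℂ} (hτq : q = Complex.exp (2 * Real.pi * I * τ)) (j : ℤ) :
    g τ (j + 1) = - (q ^ j * q) * g τ j := by
  unfold g
  rw [zpow_add₀ (by norm_num), hτq, ← Complex.exp_int_mul]
  rw [show (Real.pi * I * τ * (((j + 1 : ℤ) : ℂ) * (((j + 1 : ℤ) : ℂ) + 1)))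
    = j * (2 * Real.pi * I * τ) + 2 * Real.pi * I * τ + Real.pi * I * τ * (j * (j + 1)) by
      push_cast; ring, Complex.exp_add, Complex.exp_add]
  ring

lemma b_succ {τ q : ℂ} (hq : ‖q‖ < 1) (hτq : q = Complex.exp (2 * Real.pi * I * τ))
    (n : ℕ) (j : ℤ) : b τ q (n + 1) j =
      (1 + (q ^ (n + 1)) ^ 2) * b τ q n j - q ^ (n + 1) * (b τ q n (j - 1) + b τ q n (j + 1)) := by
  have hq0 : q ≠ 0 := by rw [hτq]; exact Complex.exp_ne_zero _
  have hz : q ^ j ≠ 0 := zpow_ne_zero _ hq0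
  have g1 := g_succ hτq j
  have g2 := g_succ hτq (j - 1)
  rw [sub_add_cancel] at g2
  have gpa : g τ (j - 1) * q ^ j = - g τ j := by
    rw [g2, zpow_sub_one₀ hq0]; field_simp
  have gpb : g τ (j - 1) = - g τ j * (q ^ j)⁻¹ := by
    rw [← gpa]; field_simp
  unfold b
  rw [g1, gpb, show 2 * (n + 1) + 1 = 2 * n + 1 + 1 + 1 by ring, qf_succ, qf_succ]
  have e1 := w_pred hq ((n : ℤ) + 1 - j)
  have e2 := w_pred hq ((n : ℤ) - j)
  have e3 := w_pred hq ((n : ℤ) + j + 2)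
  have e4 := w_pred hq ((n : ℤ) + j + 1)
  rw [show (n : ℤ) + 1 - j - 1 = n - j by ring] at e1
  rw [show (n : ℤ) + j + 2 - 1 = n + j + 1 by ring] at e3
  rw [show (n : ℤ) + j + 1 - 1 = n + j by ring] at e4
  rw [show (n : ℤ) - (j - 1) = n + 1 - j by ring, show (n : ℤ) + (j - 1) + 1 = n + j by ring,
    show (n : ℤ) - (j + 1) = n - j - 1 by ring, show (n : ℤ) + (j + 1) + 1 = n + j + 2 by ring,
    show (((n + 1 : ℕ) : ℤ) - j) = n + 1 - j by push_cast; ring,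
    show (((n + 1 : ℕ) : ℤ) + j + 1) = n + j + 2 by push_cast; ring,
    e2, e4, e1, e3]
  have z1 : q ^ ((n : ℤ) - j) = q ^ n * (q ^ j)⁻¹ := by
    rw [zpow_sub₀ hq0, zpow_natCast]; rfl
  have z2 : q ^ ((n : ℤ) + 1 - j) = q ^ n * q * (q ^ j)⁻¹ := by
    rw [zpow_sub₀ hq0, zpow_add_one₀ hq0, zpow_natCast]; rfl
  have z3 : q ^ ((n : ℤ) + j + 1) = q ^ n * q ^ j * q := by
    rw [zpow_add_one₀ hq0, zpow_add₀ hq0, zpow_natCast]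
  have z4 : q ^ ((n : ℤ) + j + 2) = q ^ n * q ^ j * q ^ 2 := by
    rw [zpow_add₀ hq0, zpow_add₀ hq0, zpow_natCast]; rfl
  rw [z1, z2, z3, z4]
  generalize w q ((n : ℤ) + 1 - j) = A
  generalize w q ((n : ℤ) + j + 2) = B
  generalize q ^ j = z at *
  field_simp
  ring

lemma b_support {τ q : ℂ} (n : ℕ) (f : ℤ → ℂ) : Summable fun j => f j * b τ q n j := by
  apply summable_of_hasFiniteSupport
  refine (Set.finite_Icc (-(n : ℤ) - 1) n).subset fun j hj => ?_
  by_contra h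
  apply hj
  simp only [Set.mem_Icc, not_and_or, not_le] at h
  rcases h with h | h
  · simp [b, w_neg q (show (n : ℤ) + j + 1 < 0 by omega)]
  · simp [b, w_neg q (show (n : ℤ) - j < 0 by omega)]

/-- linear functional -/
noncomputable def L (τ q : ℂ) (n : ℕ) (f : ℤ → ℂ) : ℂ := ∑' j, f j * b τ q n j

lemma L_succ {τ q : ℂ} (hq : ‖q‖ < 1) (hτq : q = Complex.exp (2 * Real.pi * I * τ))
    (n : ℕ) (f : ℤ → ℂ) : L τ q (n + 1) f =
      L τ q n (fun j => (1 + (q ^ (n + 1)) ^ 2) * f j - q ^ (n + 1) * (f (j + 1) + f (j - 1))) := by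
  have h0 := (b_support (τ := τ) (q := q) n f).hasSum
  have h1 := (b_support (τ := τ) (q := q) n (fun j => f (j + 1))).hasSum
  have h2 := (b_support (τ := τ) (q := q) n (fun j => f (j - 1))).hasSum
  have hs1 := (Equiv.subRight (1 : ℤ)).hasSum_iff.mpr h1
  have hs2 := (Equiv.addRight (1 : ℤ)).hasSum_iff.mpr h2
  have hA := (h0.mul_left (1 + (q ^ (n + 1)) ^ 2)).sub ((hs1.add hs2).mul_left (q ^ (n + 1)))
  have hB := (h0.mul_left (1 + (q ^ (n + 1)) ^ 2)).sub ((h1.add h2).mul_left (q ^ (n + 1)))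
  unfold L
  trans
  · refine Eq.trans (tsum_congr fun j => ?_) hA.tsum_eq
    simp only [Function.comp_apply, Equiv.subRight_apply, Equiv.coe_addRight, sub_add_cancel,
      add_sub_cancel_right]
    rw [b_succ hq hτq]
    ring
  · refine Eq.trans hB.tsum_eq.symm (tsum_congr fun j => ?_)
    ring

lemma L_lin {τ q : ℂ} (n : ℕ) (a c d : ℂ) (f1 f2 f3 : ℤ → ℂ) :
    L τ q n (fun j => a * f1 j + c * f2 j + d * f3 j) =
      a * L τ q n f1 + c * L τ q n f2 + d * L τ q n f3 := by
  have h1 := (b_support (τ := τ) (q := q) n f1).hasSum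
  have h2 := (b_support (τ := τ) (q := q) n f2).hasSum
  have h3 := (b_support (τ := τ) (q := q) n f3).hasSum
  have := ((h1.mul_left a).add (h2.mul_left c)).add (h3.mul_left d)
  unfold L
  rw [← this.tsum_eq]
  exact tsum_congr fun j => by ring

noncomputable def tt (q : ℂ) (k : ℕ) : ℂ := q ^ (k + 1) / (1 - q ^ (k + 1)) ^ 2

lemma L_zero {τ q : ℂ} (hq : ‖q‖ < 1) (f : ℤ → ℂ) :
    L τ q 0 f = f 0 - f (-1) := by
  have hs : ∀ j ∉ ({0, -1} : Finset ℤ), f j * b τ q 0 j = 0 := by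
    intro j hj
    simp only [Finset.mem_insert, Finset.mem_singleton, not_or] at hj
    rcases lt_or_gt_of_ne hj.1 with h | h
    · simp [b, w_neg q (show j + 1 < 0 by omega)]
    · simp [b, w_neg q (show -j < 0 by omega)]
  unfold L
  rw [tsum_eq_sum hs, Finset.sum_pair (by norm_num)]
  have h1 := one_sub_ne hq 0
  have w0 : w q 0 = 1 := by simp [w, qf]
  have w1 : w q 1 = (1 - q)⁻¹ := by simp [w, qf]
  simp only [zero_add, pow_one] at h1
  simp [b, g, w0, w1, qf, h1]
  field_simp
  ring

lemma moments {τ q : ℂ} (hq : ‖q‖ < 1) (hτq : q = Complex.exp (2 * Real.pi * I * τ)) (n : ℕ) :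
    L τ q n (fun j => (2 * (j : ℂ) + 1)) = 2 * qf q n ^ 2 ∧
    L τ q n (fun j => (2 * (j : ℂ) + 1) ^ 3) =
      2 * qf q n ^ 2 * (1 - 24 * ∑ k ∈ Finset.range n, tt q k) ∧
    L τ q n (fun j => (2 * (j : ℂ) + 1) ^ 5) =
      2 * qf q n ^ 2 * (1 - 240 * ∑ k ∈ Finset.range n, tt q k
        + 960 * ((∑ k ∈ Finset.range n, tt q k) ^ 2 - ∑ k ∈ Finset.range n, tt q k ^ 2)) := by
  induction n with
  | zero => simp only [L_zero hq]; simp [qf]; norm_num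
  | succ n ih =>
    obtain ⟨h1, h3, h5⟩ := ih
    have hx := one_sub_ne hq n
    have key (k : ℕ) (a c d : ℂ) (h : ∀ y : ℂ, (1 + (q ^ (n + 1)) ^ 2) * (2 * y + 1) ^ k
        - q ^ (n + 1) * ((2 * (y + 1) + 1) ^ k + (2 * (y - 1) + 1) ^ k)
        = a * (2 * y + 1) + c * (2 * y + 1) ^ 3 + d * (2 * y + 1) ^ 5) :
        L τ q (n + 1) (fun j => (2 * (j : ℂ) + 1) ^ k) =
          a * L τ q n (fun j => (2 * (j : ℂ) + 1)) +
          c * L τ q n (fun j => (2 * (j : ℂ) + 1) ^ 3) +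
          d * L τ q n (fun j => (2 * (j : ℂ) + 1) ^ 5) := by
      rw [L_succ hq hτq, ← L_lin]
      congr 1
      ext j
      push_cast
      exact h j
    have k1 := key 1 ((1 - q ^ (n + 1)) ^ 2) 0 0 (fun y => by ring)
    have k3 := key 3 (-24 * q ^ (n + 1)) ((1 - q ^ (n + 1)) ^ 2) 0 (fun y => by ring)
    have k5 := key 5 (-160 * q ^ (n + 1)) (-80 * q ^ (n + 1)) ((1 - q ^ (n + 1)) ^ 2)
      (fun y => by ring)
    simp only [pow_one] at k1
    have ht : q ^ (n + 1) = tt q n * (1 - q ^ (n + 1)) ^ 2 := by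
      unfold tt; field_simp
    simp only [Finset.sum_range_succ, qf_succ]
    rw [k1, k3, k5, h1, h3, h5]
    generalize ∑ k ∈ Finset.range n, tt q k = e1
    generalize ∑ k ∈ Finset.range n, tt q k ^ 2 = p2
    generalize tt q n = t at *
    generalize q ^ (n + 1) = x at *
    generalize qf q n = F at *
    refine ⟨by ring, ?_, ?_⟩
    · linear_combination (-48 * F ^ 2) * ht
    · linear_combination (-160 * 2 * F ^ 2 - 80 * 2 * F ^ 2 * (1 - 24 * e1)) * ht

lemma qf_tendsto {q : ℂ} (hq : ‖q‖ < 1) :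
    Tendsto (qf q) atTop (𝓝 (∏' n : ℕ, (1 - q ^ (n + 1)))) :=
  (ModularForm.multipliable_one_sub_pow hq).hasProd.tendsto_prod_nat

lemma qinf_ne {q : ℂ} (hq : ‖q‖ < 1) : ∏' n : ℕ, (1 - q ^ (n + 1)) ≠ 0 := by
  simp only [sub_eq_add_neg]
  refine tprod_one_add_ne_zero_of_summable (f := fun n => -q ^ (n + 1)) ?_ ?_
  · exact fun i => by simpa [sub_eq_add_neg] using one_sub_ne hq i
  · simpa using (summable_nat_add_iff 1).mpr (summable_geometric_of_lt_one (norm_nonneg _) hq)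

lemma qf_bound {q : ℂ} (hq : ‖q‖ < 1) : ∃ C, ∀ n, ‖qf q n‖ ≤ C := by
  obtain ⟨C, hC⟩ := isBounded_iff_forall_norm_le.mp
    (Metric.isBounded_range_of_tendsto _ (qf_tendsto hq))
  exact ⟨C, fun n => hC _ ⟨n, rfl⟩⟩

lemma w_bound {q : ℂ} (hq : ‖q‖ < 1) : ∃ C, 0 ≤ C ∧ ∀ k, ‖w q k‖ ≤ C := by
  obtain ⟨C, hC⟩ := isBounded_iff_forall_norm_le.mp
    (Metric.isBounded_range_of_tendsto _ ((qf_tendsto hq).inv₀ (qinf_ne hq)))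
  have hCn (n) : ‖(qf q n)⁻¹‖ ≤ C := hC _ ⟨n, rfl⟩
  have hC0 : 0 ≤ C := (norm_nonneg _).trans (hCn 0)
  refine ⟨C, hC0, fun k => ?_⟩
  unfold w
  split_ifs
  · exact hCn _
  · simpa using hC0

lemma w_tendsto {q : ℂ} (hq : ‖q‖ < 1) (j : ℤ) :
    Tendsto (fun n : ℕ => w q (n + j)) atTop (𝓝 (∏' n : ℕ, (1 - q ^ (n + 1)))⁻¹) := by
  have h := (qf_tendsto hq).inv₀ (qinf_ne hq)
  have h2 : Tendsto (fun n : ℕ => ((n : ℤ) + j).toNat) atTop atTop := by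
    refine tendsto_atTop.mpr fun B => ?_
    filter_upwards [eventually_ge_atTop (B + j.natAbs)] with n hn
    omega
  refine (h.comp h2).congr' ?_
  filter_upwards [eventually_ge_atTop (j.natAbs)] with n hn
  simp [w, show 0 ≤ (n : ℤ) + j by omega]

lemma b_tendsto {τ q : ℂ} (hq : ‖q‖ < 1) (j : ℤ) :
    Tendsto (fun n : ℕ => b τ q n j) atTop (𝓝 (g τ j * (∏' n : ℕ, (1 - q ^ (n + 1)))⁻¹)) := by
  have h1 := (qf_tendsto hq).comp (tendsto_atTop_mono (fun n => by omega : ∀ n : ℕ, n ≤ 2 * n + 1)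
    tendsto_id)
  have h2 := w_tendsto hq (-j)
  have h3 := w_tendsto hq (j + 1)
  have := (h1.mul_const (g τ j)).mul (h2.mul h3)
  have hne := qinf_ne hq
  convert this using 2
  · simp [b, add_assoc, sub_eq_add_neg]
  · field_simp

lemma b_bound {τ q : ℂ} (hq : ‖q‖ < 1) : ∃ C, 0 ≤ C ∧ ∀ n j, ‖b τ q n j‖ ≤ C * ‖g τ j‖ := by
  obtain ⟨C, hC⟩ := qf_bound hq
  obtain ⟨K, hK0, hK⟩ := w_bound hq
  have hC0 : 0 ≤ C := (norm_nonneg _).trans (hC 0)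
  refine ⟨C * (K * K), by positivity, fun n j => ?_⟩
  unfold b
  rw [norm_mul, norm_mul, norm_mul]
  calc _ ≤ C * ‖g τ j‖ * (K * K) := by gcongr <;> apply_assumption
    _ = _ := by ring

lemma g_norm_le {τ : ℂ} (hτ : 0 < τ.im) (j : ℤ) :
    ‖g τ j‖ ≤ Real.exp (-Real.pi * (τ.im * j ^ 2 - 2 * (τ.im / 2) * |j|)) := by
  unfold g
  rw [norm_mul, norm_zpow, norm_neg, norm_one, one_zpow, one_mul, Complex.norm_exp]
  apply Real.exp_le_exp.mpr
  have : (Real.pi * I * τ * (j * (j + 1)) : ℂ).re = -Real.pi * (τ.im * (j ^ 2 + j)) := by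
    rw [show (Real.pi * I * τ * (j * (j + 1)) : ℂ) = ((Real.pi * (j * (j + 1)) : ℝ) : ℂ) * (I * τ) by
      push_cast; ring, Complex.re_ofReal_mul]
    simp; ring
  rw [this]
  have h := neg_abs_le (j : ℝ)
  have hp : 0 ≤ Real.pi * τ.im := by have := Real.pi_pos; positivity
  push_cast
  nlinarith [mul_nonneg hp (by linarith : 0 ≤ (j : ℝ) + |(j : ℝ)|)]

lemma summable_bound {τ : ℂ} (hτ : 0 < τ.im) :
    Summable fun j : ℤ => ‖(2 * (j : ℂ) + 1) ^ 5‖ * ‖g τ j‖ := by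
  have h5 := summable_pow_mul_jacobiTheta₂_term_bound (τ.im / 2) hτ 5
  have h0 := summable_pow_mul_jacobiTheta₂_term_bound (τ.im / 2) hτ 0
  refine Summable.of_nonneg_of_le (fun j => by positivity) (fun j => ?_) ((h5.mul_left 243).add h0)
  have hg := g_norm_le hτ j
  have hα : ‖(2 * (j : ℂ) + 1) ^ 5‖ ≤ 243 * (|j| : ℝ) ^ 5 + 1 := by
    rw [norm_pow]
    by_cases hj : j = 0
    · simp [hj]
    · have h1 : (1 : ℝ) ≤ |(j : ℝ)| := by exact_mod_cast Int.one_le_abs hj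
      have h2 : ‖2 * (j : ℂ) + 1‖ ≤ 3 * |(j : ℝ)| := by
        calc _ ≤ ‖2 * (j : ℂ)‖ + ‖(1 : ℂ)‖ := norm_add_le _ _
          _ = 2 * |(j : ℝ)| + 1 := by simp
          _ ≤ _ := by linarith
      calc _ ≤ (3 * |(j : ℝ)|) ^ 5 := by gcongr
        _ ≤ _ := by push_cast; nlinarith
  calc _ ≤ (243 * (|j| : ℝ) ^ 5 + 1) *
        Real.exp (-Real.pi * (τ.im * j ^ 2 - 2 * (τ.im / 2) * |j|)) := by gcongr
    _ = _ := by push_cast; ring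

lemma L_tendsto {τ q : ℂ} (hτ : 0 < τ.im) (hq : ‖q‖ < 1) :
    Tendsto (fun n => L τ q n (fun j => (2 * (j : ℂ) + 1) ^ 5)) atTop
      (𝓝 (∑' j : ℤ, (2 * (j : ℂ) + 1) ^ 5 * (g τ j * (∏' n : ℕ, (1 - q ^ (n + 1)))⁻¹))) := by
  obtain ⟨C, hC0, hC⟩ := b_bound (τ := τ) hq
  refine tendsto_tsum_of_dominated_convergence ((summable_bound hτ).mul_left C) ?_ ?_
  · exact fun j => (b_tendsto hq j).const_mul _
  · refine Eventually.of_forall fun n j => ?_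
    rw [norm_mul]
    calc _ ≤ ‖(2 * (j : ℂ) + 1) ^ 5‖ * (C * ‖g τ j‖) := by gcongr; exact hC n j
      _ = _ := by ring

lemma hs_congr {ι : Type*} {f h : ι → ℂ} {a : ℂ} (hf : HasSum f a) (e : ∀ i, h i = f i) :
    HasSum h a := by
  rwa [show h = f from funext e]

lemma summable_double {q : ℂ} (hq : ‖q‖ < 1) (k : ℕ) :
    Summable fun c : ℕ × ℕ => ((c.2 : ℂ) + 1) ^ k * q ^ ((c.1 + 1) * (c.2 + 1)) := by
  have h := summable_prod_mul_pow k hq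
  have := (Equiv.prodCongr Equiv.pnatEquivNat Equiv.pnatEquivNat).symm.summable_iff.mpr h
  refine this.congr fun c => ?_
  simp [Equiv.pnatEquivNat]

lemma norm_pow_lt {q : ℂ} (hq : ‖q‖ < 1) (k : ℕ) : ‖q ^ (k + 1)‖ < 1 := by
  rw [norm_pow]; exact pow_lt_one₀ (norm_nonneg _) hq (by omega)

lemma hasSum_tt {q : ℂ} (hq : ‖q‖ < 1) (k : ℕ) :
    HasSum (fun m : ℕ => ((m : ℂ) + 1) ^ 1 * q ^ ((k + 1) * (m + 1))) (tt q k) := by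
  have h := (hasSum_choose_mul_geometric_of_norm_lt_one 1 (norm_pow_lt hq k)).mul_left (q ^ (k + 1))
  have e : q ^ (k + 1) * (1 / (1 - q ^ (k + 1)) ^ (1 + 1)) = tt q k := by unfold tt; ring
  rw [e] at h
  refine hs_congr h fun m => ?_
  rw [Nat.choose_one_right, pow_mul]
  push_cast
  ring

lemma hasSum_tt_sq {q : ℂ} (hq : ‖q‖ < 1) (k : ℕ) :
    HasSum (fun m : ℕ => (((m : ℂ) + 1) ^ 3 * q ^ ((k + 1) * (m + 1)) -
      ((m : ℂ) + 1) ^ 1 * q ^ ((k + 1) * (m + 1))) / 6) (tt q k ^ 2) := by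
  have h := (hasSum_choose_mul_geometric_of_norm_lt_one 3 (norm_pow_lt hq k)).mul_left
    ((q ^ (k + 1)) ^ 2)
  rw [← hasSum_nat_add_iff' 1]
  have e : (q ^ (k + 1)) ^ 2 * (1 / (1 - q ^ (k + 1)) ^ (3 + 1)) = tt q k ^ 2 := by
    unfold tt; rw [div_pow, ← pow_mul (1 - q ^ (k + 1)), mul_one_div]
  rw [e] at h
  rw [Finset.sum_range_one]
  simp only [Nat.cast_zero, zero_add, one_pow, sub_self, zero_div, sub_zero]
  refine hs_congr h fun m => ?_
  · have hc : (((m + 3).choose 3 : ℕ) : ℂ) * 6 = (m + 1) * (m + 2) * (m + 3) := by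
      have h1 := Nat.descFactorial_eq_factorial_mul_choose (m + 3) 3
      have h2 : (m + 3).descFactorial 3 = (m + 1) * (m + 2) * (m + 3) := by
        simp [Nat.descFactorial]; ring
      rw [h2] at h1
      have h3 : (((m + 1) * (m + 2) * (m + 3) : ℕ) : ℂ) = ((Nat.factorial 3 * (m + 3).choose 3 : ℕ) : ℂ) := by
        rw [h1]
      push_cast [Nat.factorial] at h3
      linear_combination -h3
    rw [pow_mul, pow_add _ (m + 1) 1, pow_add _ m 1]
    push_cast
    linear_combination (-((q ^ (k + 1)) ^ 2 * (q ^ (k + 1)) ^ m) / 6) * hc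

lemma lambert {q : ℂ} (hq : ‖q‖ < 1) (k : ℕ) :
    HasSum (fun n : ℕ => ∑' m : ℕ, ((m : ℂ) + 1) ^ k * q ^ ((n + 1) * (m + 1))) (Phi k q) := by
  have hs := summable_double hq k
  have e : Phi k q = ∑' n : ℕ, ∑' m : ℕ, ((m : ℂ) + 1) ^ k * q ^ ((n + 1) * (m + 1)) := by
    have hc := Summable.tsum_comm
      (f := fun n m : ℕ => ((m : ℂ) + 1) ^ k * q ^ ((n + 1) * (m + 1))) hs
    refine Eq.trans ?_ hc
    unfold Phi
    refine tsum_congr fun m => ?_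
    have h := (hasSum_geometric_of_norm_lt_one (norm_pow_lt hq m)).mul_left
      (((m : ℂ) + 1) ^ k * q ^ (m + 1))
    rw [div_eq_mul_inv, ← h.tsum_eq]
    refine tsum_congr fun n => ?_
    rw [mul_comm (n + 1), pow_mul, pow_succ (q ^ (m + 1))]
    ring
  rw [e]
  exact hs.prod.hasSum

lemma hasSum_sum_tt {q : ℂ} (hq : ‖q‖ < 1) : HasSum (tt q) (Phi 1 q) := by
  refine hs_congr (lambert hq 1) fun n => ?_
  exact (hasSum_tt hq n).tsum_eq.symm

lemma hasSum_sum_tt_sq {q : ℂ} (hq : ‖q‖ < 1) :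
    HasSum (fun k => tt q k ^ 2) ((Phi 3 q - Phi 1 q) / 6) := by
  refine hs_congr (((lambert hq 3).sub (lambert hq 1)).div_const 6) fun n => ?_
  rw [← (hasSum_tt_sq hq n).tsum_eq, tsum_div_const]
  congr 1
  exact ((summable_double hq 3).prod_factor n).tsum_sub ((summable_double hq 1).prod_factor n)

lemma theta_five {τ q : ℂ} (hτ : 0 < τ.im) (hq : ‖q‖ < 1)
    (hτq : q = Complex.exp (2 * Real.pi * I * τ)) :
    ∑' j : ℤ, (2 * (j : ℂ) + 1) ^ 5 * g τ j = 2 * (∏' n : ℕ, (1 - q ^ (n + 1))) ^ 3 *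
      (1 - 240 * Phi 1 q + 960 * (Phi 1 q ^ 2 - (Phi 3 q - Phi 1 q) / 6)) := by
  have h1 := L_tendsto hτ hq
  have he := (hasSum_sum_tt hq).tendsto_sum_nat
  have hp := (hasSum_sum_tt_sq hq).tendsto_sum_nat
  have h2 := (((qf_tendsto hq).pow 2).const_mul 2).mul
    (((he.const_mul 240).const_sub 1).add (((he.pow 2).sub hp).const_mul 960))
  have h3 := tendsto_nhds_unique h1 (h2.congr fun n => (moments hq hτq n).2.2.symm)
  have hne := qinf_ne hq
  simp only [← mul_assoc] at h3
  rw [tsum_mul_right, ← div_eq_mul_inv, div_eq_iff hne] at h3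
  rw [h3]
  ring

lemma theta_split {τ : ℂ} (hτ : 0 < τ.im) :
    ∑' j : ℤ, (2 * (j : ℂ) + 1) ^ 5 * g τ j =
      2 * ∑' m : ℤ, (4 * (m : ℂ) + 1) ^ 5 * Complex.exp (Real.pi * I * τ * (2 * m * (2 * m + 1))) := by
  have hs : Summable fun j : ℤ => (2 * (j : ℂ) + 1) ^ 5 * g τ j :=
    Summable.of_norm (by simpa only [norm_mul] using summable_bound hτ)
  have i1 : Function.Injective (fun m : ℤ => 2 * m) := fun a b h => by simp at h; omega
  have i2 : Function.Injective (fun m : ℤ => -(2 * m) - 1) := fun a b h => by simp at h; omega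
  have hc : IsCompl (Set.range fun m : ℤ => 2 * m) (Set.range fun m : ℤ => -(2 * m) - 1) := by
    rw [isCompl_iff, Set.disjoint_iff, codisjoint_iff]
    constructor
    · rintro x ⟨⟨a, rfl⟩, ⟨b, hb⟩⟩
      simp only at hb
      omega
    · ext x
      simp only [Set.sup_eq_union, Set.top_eq_univ, Set.mem_union, Set.mem_range, Set.mem_univ, iff_true]
      rcases Int.even_or_odd' x with ⟨k, h | h⟩
      · exact Or.inl ⟨k, h.symm⟩
      · exact Or.inr ⟨-k - 1, by omega⟩
  have f1 : ∀ m : ℤ, (2 * ((2 * m : ℤ) : ℂ) + 1) ^ 5 * g τ (2 * m) =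
      (4 * (m : ℂ) + 1) ^ 5 * Complex.exp (Real.pi * I * τ * (2 * m * (2 * m + 1))) := by
    intro m
    unfold g
    rw [zpow_mul]
    push_cast
    norm_num
    rw [show (2 * (2 * m) + 1 : ℂ) = 4 * m + 1 by ring]
  have f2 : ∀ m : ℤ, (2 * ((-(2 * m) - 1 : ℤ) : ℂ) + 1) ^ 5 * g τ (-(2 * m) - 1) =
      (4 * (m : ℂ) + 1) ^ 5 * Complex.exp (Real.pi * I * τ * (2 * m * (2 * m + 1))) := by
    intro m
    unfold g
    rw [zpow_sub_one₀ (by norm_num), zpow_neg, zpow_mul]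
    push_cast
    rw [show (Real.pi * I * τ * ((-(2 * m) - 1) * (-(2 * m) - 1 + 1)) : ℂ) =
      Real.pi * I * τ * (2 * m * (2 * m + 1)) by ring]
    norm_num
    ring
  have s1 := (i1.hasSum_range_iff (f := fun j : ℤ => (2 * (j : ℂ) + 1) ^ 5 * g τ j)).mpr
    (hs.comp_injective i1).hasSum
  have s2 := (i2.hasSum_range_iff (f := fun j : ℤ => (2 * (j : ℂ) + 1) ^ 5 * g τ j)).mpr
    (hs.comp_injective i2).hasSum
  have s3 := HasSum.add_isCompl (f := fun j : ℤ => (2 * (j : ℂ) + 1) ^ 5 * g τ j) hc s1 s2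
  rw [s3.tsum_eq, two_mul]
  congr 1
  · exact tsum_congr f1
  · exact tsum_congr f2

end S3Proof

/-- With q = e^{2πiτ}, Im τ > 0, P = 1 − 24Φ₁, Q = 1 + 240Φ₃,
S₃(5) = ∑_{m∈ℤ} (4m+1)⁵ q^{(4m+1)²/8} = η(τ)³·(5P² − 2Q)/3. -/
theorem S3_five_eq (τ : ℂ) (hτ : 0 < τ.im) :
    (∑' m : ℤ, Complex.exp (2 * Real.pi * Complex.I * τ * ((4 * (m : ℂ) + 1) ^ 2 / 8))
        * (4 * (m : ℂ) + 1) ^ 5)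
      = (Complex.exp (2 * Real.pi * Complex.I * τ / 24)
          * ∏' n : ℕ, (1 - Complex.exp (2 * Real.pi * Complex.I * τ) ^ (n + 1))) ^ 3
        * (5 * (1 - 24 * Phi 1 (Complex.exp (2 * Real.pi * Complex.I * τ))) ^ 2
            - 2 * (1 + 240 * Phi 3 (Complex.exp (2 * Real.pi * Complex.I * τ)))) / 3 := by
  have hq : ‖Complex.exp (2 * Real.pi * Complex.I * τ)‖ < 1 :=
    UpperHalfPlane.norm_exp_two_pi_I_lt_one ⟨τ, hτ⟩
  have h1 := S3Proof.theta_five hτ hq rfl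
  rw [S3Proof.theta_split hτ] at h1
  have h2 : (∑' m : ℤ, Complex.exp (2 * Real.pi * Complex.I * τ * ((4 * (m : ℂ) + 1) ^ 2 / 8))
        * (4 * (m : ℂ) + 1) ^ 5) = Complex.exp (2 * Real.pi * Complex.I * τ / 24) ^ 3 *
      ∑' m : ℤ, (4 * (m : ℂ) + 1) ^ 5 *
        Complex.exp (Real.pi * I * τ * (2 * m * (2 * m + 1))) := by
    rw [← tsum_mul_left]
    refine tsum_congr fun m => ?_
    rw [← Complex.exp_nat_mul, mul_left_comm, ← Complex.exp_add, mul_comm]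
    congr 2
    push_cast
    ring
  rw [h2, mul_pow]
  linear_combination (Complex.exp (2 * Real.pi * Complex.I * τ / 24) ^ 3 / 2) * h1
end

section
/- With q = e^{2πiτ}, Im τ > 0, S₃(m) = ∑_{α≡1 (mod 4)} q^{α²/8}·α^m, η(τ) = q^{1/24}∏_{n≥1}(1−q^n), P = 1 − 24Φ₁(q), Q = 1 + 240Φ₃(q), R = 1 − 504Φ₅(q) where Φ_ν(q) = ∑_{n≥1} n^ν q^n/(1−q^n), we have S₃(7) = η(τ)³·(35P³ − 42PQ + 16R)/9. -/
open Complex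

open Filter Topology

namespace S3

/-- finite q-Pochhammer symbol -/
noncomputable def qp (q : ℂ) (n : ℕ) : ℂ := ∏ i ∈ Finset.range n, (1 - q ^ (i + 1))

/-- reciprocal of the q-Pochhammer symbol, extended by zero -/
noncomputable def rr (q : ℂ) (n : ℤ) : ℂ := if 0 ≤ n then (qp q n.toNat)⁻¹ else 0

/-- finite theta coefficients -/
noncomputable def aa (q : ℂ) (w : ℤ → ℂ) (N : ℕ) (j : ℤ) : ℂ :=
  w j * qp q (2 * N + 1) * rr q (N - j) * rr q (N + 1 + j)

lemma one_sub_ne {q : ℂ} (hq : ‖q‖ < 1) (n : ℕ) : 1 - q ^ (n + 1) ≠ 0 := by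
  intro h
  have h1 : ‖q ^ (n + 1)‖ = 1 := by
    rw [← sub_eq_zero.mp h]; simp
  rw [norm_pow] at h1
  have := pow_lt_one₀ (norm_nonneg q) hq (Nat.succ_ne_zero n)
  simp only [Nat.succ_eq_add_one] at this
  linarith

lemma qp_ne {q : ℂ} (hq : ‖q‖ < 1) (n : ℕ) : qp q n ≠ 0 :=
  Finset.prod_ne_zero_iff.mpr fun i _ => one_sub_ne hq i

lemma qp_succ (q : ℂ) (n : ℕ) : qp q (n + 1) = qp q n * (1 - q ^ (n + 1)) := by
  simp [qp, Finset.prod_range_succ]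

lemma rr_pred {q : ℂ} (hq : ‖q‖ < 1) (n : ℤ) : rr q (n - 1) = (1 - q ^ n) * rr q n := by
  rcases lt_trichotomy n 0 with h | h | h
  · rw [rr, rr, if_neg (by omega), if_neg (by omega), mul_zero]
  · subst h
    simp [rr]
  · obtain ⟨m, rfl⟩ : ∃ m : ℕ, n = (m : ℤ) + 1 := ⟨(n - 1).toNat, by omega⟩
    have h1 : ((m : ℤ) + 1 - 1) = m := by ring
    have h2 : ((m : ℤ) + 1).toNat = m + 1 := by omega
    rw [rr, rr, h1, if_pos (by omega), if_pos (by omega), h2, Int.toNat_natCast, qp_succ]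
    have h3 : q ^ ((m : ℤ) + 1) = q ^ (m + 1) := by exact_mod_cast zpow_natCast q (m + 1)
    rw [h3]
    have := one_sub_ne hq m
    have := qp_ne hq m
    field_simp

lemma aa_succ {q : ℂ} (hq0 : q ≠ 0) (hq : ‖q‖ < 1) {w : ℤ → ℂ}
    (hw : ∀ j, w (j + 1) = -(w j * q ^ (j + 1))) (N : ℕ) (j : ℤ) :
    aa q w (N + 1) j = (1 + (q ^ (N + 1)) ^ 2) * aa q w N j
      - q ^ (N + 1) * (aa q w N (j - 1) + aa q w N (j + 1)) := by
  have e1 : rr q ((N : ℤ) - j) = (1 - q ^ (N + 1 - j : ℤ)) * rr q (N + 1 - j) := by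
    rw [← rr_pred hq]; congr 1; ring
  have e2 : rr q ((N : ℤ) - (j + 1)) = (1 - q ^ (N - j : ℤ)) * rr q (N - j) := by
    rw [← rr_pred hq]; congr 1; ring
  have e3 : rr q ((N : ℤ) + 1 + j) = (1 - q ^ (N + 2 + j : ℤ)) * rr q (N + 2 + j) := by
    rw [← rr_pred hq]; congr 1; ring
  have e4 : rr q ((N : ℤ) + 1 + (j - 1)) = (1 - q ^ (N + 1 + j : ℤ)) * rr q (N + 1 + j) := by
    rw [← rr_pred hq]; congr 1; ring
  have e5 : ((N : ℤ) - (j - 1)) = N + 1 - j := by ring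
  have e6 : ((N : ℤ) + 1 + (j + 1)) = N + 2 + j := by ring
  have e7 : (((N + 1 : ℕ) : ℤ) - j) = N + 1 - j := by push_cast; ring
  have e8 : (((N + 1 : ℕ) : ℤ) + 1 + j) = N + 2 + j := by push_cast; ring
  have e9 : qp q (2 * (N + 1) + 1)
      = qp q (2 * N + 1) * (1 - q ^ (2 * N + 2)) * (1 - q ^ (2 * N + 3)) := by
    rw [show 2 * (N + 1) + 1 = (2 * N + 1 + 1) + 1 by ring, qp_succ, qp_succ]
  have hX : q ^ j ≠ 0 := zpow_ne_zero _ hq0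
  have w1 : w (j - 1) = -(w j * (q ^ j)⁻¹) := by
    have := hw (j - 1)
    rw [sub_add_cancel] at this
    rw [this]; field_simp
  have w2 : w (j + 1) = -(w j * (q ^ j * q)) := by rw [hw, zpow_add_one₀ hq0]
  have z1 : q ^ (N + 1 - j : ℤ) = q ^ N * q * (q ^ j)⁻¹ := by
    rw [zpow_sub₀ hq0, zpow_add_one₀ hq0, zpow_natCast]; rfl
  have z2 : q ^ (N - j : ℤ) = q ^ N * (q ^ j)⁻¹ := by
    rw [zpow_sub₀ hq0, zpow_natCast]; rfl
  have z3 : q ^ (N + 1 + j : ℤ) = q ^ N * q * q ^ j := by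
    rw [zpow_add₀ hq0, zpow_add_one₀ hq0, zpow_natCast]
  have z4 : q ^ (N + 2 + j : ℤ) = q ^ N * q ^ 2 * q ^ j := by
    rw [zpow_add₀ hq0, zpow_add₀ hq0, zpow_natCast]; rfl
  unfold aa
  rw [e5, e6, e7, e8, e9, e2, e4, e1, e3, w1, w2, z1, z2, z3, z4]
  generalize rr q (N + 1 - j) = A
  generalize rr q (N + 2 + j) = B
  generalize q ^ j = X at *
  rw [show 2 * N + 2 = N + N + 2 by ring, show 2 * N + 3 = N + N + 3 by ring]
  simp only [pow_add]
  generalize q ^ N = Y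
  field_simp
  ring

lemma aa_zero_of {q : ℂ} {w : ℤ → ℂ} (N : ℕ) (j : ℤ) (hj : j ∉ Finset.Icc (-(N : ℤ) - 1) N) :
    aa q w N j = 0 := by
  rw [Finset.mem_Icc, not_and_or] at hj
  rcases hj with h | h
  · simp [aa, rr, if_neg (show ¬ (0 ≤ (N : ℤ) + 1 + j) by omega)]
  · rw [aa]
    rw [show rr q (N - j) = 0 from if_neg (by omega)]; simp

lemma aa_summable {q : ℂ} {w : ℤ → ℂ} (N : ℕ) (D : ℤ → ℂ) :
    Summable fun j => aa q w N j * D j :=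
  summable_of_ne_finset_zero (s := Finset.Icc (-(N : ℤ) - 1) N) fun j hj => by
    rw [aa_zero_of N j hj, zero_mul]

/-- weighted sums -/
noncomputable def TT (q : ℂ) (w : ℤ → ℂ) (N : ℕ) (D : ℤ → ℂ) : ℂ := ∑' j, aa q w N j * D j

lemma TT_succ {q : ℂ} (hq0 : q ≠ 0) (hq : ‖q‖ < 1) {w : ℤ → ℂ}
    (hw : ∀ j, w (j + 1) = -(w j * q ^ (j + 1))) (N : ℕ) (D D' : ℤ → ℂ)
    (hD : ∀ j, D (j + 1) + D (j - 1) = 2 * D j + D' j) :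
    TT q w (N + 1) D = (1 - q ^ (N + 1)) ^ 2 * TT q w N D - q ^ (N + 1) * TT q w N D' := by
  have s0 := aa_summable (q := q) (w := w) N D
  have s0' := aa_summable (q := q) (w := w) N D'
  have sp := aa_summable (q := q) (w := w) N (fun j => D (j + 1))
  have sm := aa_summable (q := q) (w := w) N (fun j => D (j - 1))
  have t1 : ∑' j, aa q w N (j - 1) * D j = ∑' j, aa q w N j * D (j + 1) := by
    rw [← (Equiv.addRight (1 : ℤ)).tsum_eq]; simp
  have t2 : ∑' j, aa q w N (j + 1) * D j = ∑' j, aa q w N j * D (j - 1) := by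
    rw [← (Equiv.subRight (1 : ℤ)).tsum_eq]; simp
  have s1 : Summable fun j => aa q w N (j - 1) * D j := by
    rw [← (Equiv.addRight (1 : ℤ)).summable_iff]; simpa [Function.comp_def] using sp
  have s2 : Summable fun j => aa q w N (j + 1) * D j := by
    rw [← (Equiv.subRight (1 : ℤ)).summable_iff]; simpa [Function.comp_def] using sm
  have t3 : ∑' j, aa q w N j * D (j + 1) + ∑' j, aa q w N j * D (j - 1)
      = 2 * ∑' j, aa q w N j * D j + ∑' j, aa q w N j * D' j := by
    rw [← sp.tsum_add sm, ← tsum_mul_left, ← (s0.mul_left 2).tsum_add s0']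
    refine tsum_congr fun j => ?_
    rw [← mul_add, hD]; ring
  have t4 : TT q w (N + 1) D = (1 + (q ^ (N + 1)) ^ 2) * ∑' j, aa q w N j * D j
      - q ^ (N + 1) * (∑' j, aa q w N (j - 1) * D j + ∑' j, aa q w N (j + 1) * D j) := by
    rw [← s1.tsum_add s2, ← tsum_mul_left, ← tsum_mul_left,
      ← (s0.mul_left _).tsum_sub ((s1.add s2).mul_left _)]
    refine tsum_congr fun j => ?_
    rw [aa_succ hq0 hq hw]; ring
  rw [t4, t1, t2, t3]
  unfold TT
  ring

lemma TT_zero {q : ℂ} (hq : ‖q‖ < 1) {w : ℤ → ℂ}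
    (hw : ∀ j, w (j + 1) = -(w j * q ^ (j + 1))) (D : ℤ → ℂ) :
    TT q w 0 D = w 0 * (D 0 - D (-1)) := by
  have h0 : w (-1) = - w 0 := by
    have := hw (-1); simp at this; rw [this]; simp
  have h1 : 1 - q ≠ 0 := by simpa using one_sub_ne hq 0
  unfold TT
  rw [tsum_eq_sum (s := Finset.Icc (-((0 : ℕ) : ℤ) - 1) (0 : ℕ)) fun j hj => by
    rw [aa_zero_of 0 j hj, zero_mul]]
  have : Finset.Icc (-((0 : ℕ) : ℤ) - 1) ((0 : ℕ) : ℤ) = {-1, 0} := by decide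
  rw [this, Finset.sum_pair (by decide)]
  simp [aa, rr, qp, h0]
  field_simp
  ring

noncomputable def D0 (j : ℤ) : ℂ := 2 * j + 1
noncomputable def D1 (j : ℤ) : ℂ := (2 * j + 1) * (j * (j + 1)) / 6
noncomputable def D2 (j : ℤ) : ℂ := (2 * j + 1) * (j * (j + 1)) * ((j - 1) * (j + 2)) / 120
noncomputable def D3 (j : ℤ) : ℂ :=
  (2 * j + 1) * (j * (j + 1)) * ((j - 1) * (j + 2)) * ((j - 2) * (j + 3)) / 5040

/-- the rational function `q^n/(1-q^n)^2` -/
noncomputable def yy (q : ℂ) (n : ℕ) : ℂ := q ^ (n + 1) / (1 - q ^ (n + 1)) ^ 2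

noncomputable def pp (q : ℂ) (k N : ℕ) : ℂ := ∑ n ∈ Finset.range N, yy q n ^ k

lemma pp_succ (q : ℂ) (k N : ℕ) : pp q k (N + 1) = pp q k N + yy q N ^ k := by
  simp [pp, Finset.sum_range_succ]

lemma TT_eq {q : ℂ} (hq0 : q ≠ 0) (hq : ‖q‖ < 1) {w : ℤ → ℂ}
    (hw : ∀ j, w (j + 1) = -(w j * q ^ (j + 1))) (N : ℕ) :
    TT q w N D0 = 2 * w 0 * qp q N ^ 2 ∧
    TT q w N D1 = 2 * w 0 * qp q N ^ 2 * (-pp q 1 N) ∧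
    TT q w N D2 = 2 * w 0 * qp q N ^ 2 * ((pp q 1 N ^ 2 - pp q 2 N) / 2) ∧
    TT q w N D3 = 2 * w 0 * qp q N ^ 2 *
      (-(pp q 1 N ^ 3 - 3 * pp q 1 N * pp q 2 N + 2 * pp q 3 N) / 6) := by
  induction N with
  | zero =>
    simp only [TT_zero hq hw]
    refine ⟨?_, ?_, ?_, ?_⟩ <;> simp [D0, D1, D2, D3, qp, pp]
    ring
  | succ N ih =>
    obtain ⟨i0, i1, i2, i3⟩ := ih
    have hz : ∀ j, D0 (j + 1) + D0 (j - 1) = 2 * D0 j + (fun _ => 0 : ℤ → ℂ) j := by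
      intro j; simp only [D0]; push_cast; ring
    have h1 : ∀ j, D1 (j + 1) + D1 (j - 1) = 2 * D1 j + D0 j := by
      intro j; simp only [D0, D1]; push_cast; ring
    have h2 : ∀ j, D2 (j + 1) + D2 (j - 1) = 2 * D2 j + D1 j := by
      intro j; simp only [D2, D1]; push_cast; ring
    have h3 : ∀ j, D3 (j + 1) + D3 (j - 1) = 2 * D3 j + D2 j := by
      intro j; simp only [D2, D3]; push_cast; ring
    rw [TT_succ hq0 hq hw N _ _ hz, TT_succ hq0 hq hw N _ _ h1, TT_succ hq0 hq hw N _ _ h2,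
      TT_succ hq0 hq hw N _ _ h3, i0, i1, i2, i3]
    have hzero : TT q w N (fun _ => 0) = 0 := by simp [TT]
    rw [hzero]
    have hy : q ^ (N + 1) = (1 - q ^ (N + 1)) ^ 2 * yy q N := by
      have := one_sub_ne hq N
      rw [yy]; field_simp
    simp only [pp_succ, qp_succ]
    generalize hu : 1 - q ^ (N + 1) = u at *
    rw [hy]
    refine ⟨?_, ?_, ?_, ?_⟩ <;> ring

/-! ### Limits -/

lemma qp_tendsto {q : ℂ} (hq : ‖q‖ < 1) :
    Tendsto (qp q) atTop (𝓝 (∏' n : ℕ, (1 - q ^ (n + 1)))) :=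
  (ModularForm.multipliable_one_sub_pow hq).hasProd.tendsto_prod_nat

lemma qinf_ne {q : ℂ} (hq : ‖q‖ < 1) : ∏' n : ℕ, (1 - q ^ (n + 1)) ≠ 0 := by
  have := tprod_one_add_ne_zero_of_summable (f := fun n : ℕ => -q ^ (n + 1))
    (fun i => by simpa [sub_eq_add_neg] using one_sub_ne hq i) (by
      simpa using (summable_nat_add_iff 1).mpr (summable_geometric_of_lt_one (norm_nonneg _) hq))
  simpa [sub_eq_add_neg] using this

lemma rr_tendsto {q : ℂ} (hq : ‖q‖ < 1) (f : ℕ → ℤ) (hf : Tendsto f atTop atTop) :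
    Tendsto (fun N => rr q (f N)) atTop (𝓝 (∏' n : ℕ, (1 - q ^ (n + 1)))⁻¹) := by
  have h1 : Tendsto (fun N => (f N).toNat) atTop atTop := by
    rw [tendsto_atTop] at hf ⊢
    intro b
    filter_upwards [hf b] with N hN
    omega
  have h2 := ((qp_tendsto hq).inv₀ (qinf_ne hq)).comp h1
  refine h2.congr' ?_
  filter_upwards [hf.eventually_ge_atTop 0] with N hN
  simp [rr, hN]

lemma qp_bdd {q : ℂ} (hq : ‖q‖ < 1) : ∃ C, ∀ n, ‖qp q n‖ ≤ C := by
  obtain ⟨C, hC⟩ := (Metric.isBounded_range_of_tendsto _ (qp_tendsto hq)).exists_norm_le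
  exact ⟨C, fun n => hC _ ⟨n, rfl⟩⟩

lemma rr_bdd {q : ℂ} (hq : ‖q‖ < 1) : ∃ C, 0 ≤ C ∧ ∀ n, ‖rr q n‖ ≤ C := by
  obtain ⟨C, hC⟩ := (Metric.isBounded_range_of_tendsto _
    ((qp_tendsto hq).inv₀ (qinf_ne hq))).exists_norm_le
  have h0 : 0 ≤ C := (norm_nonneg _).trans (hC _ ⟨0, rfl⟩)
  refine ⟨C, h0, fun n => ?_⟩
  unfold rr
  split_ifs
  · exact hC _ ⟨_, rfl⟩
  · simpa using h0

lemma TT_tendsto {q : ℂ} (hq : ‖q‖ < 1) {w : ℤ → ℂ} (D : ℤ → ℂ)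
    (hs : Summable fun j => w j * D j) :
    Tendsto (fun N => TT q w N D) atTop
      (𝓝 ((∑' j, w j * D j) * (∏' n : ℕ, (1 - q ^ (n + 1)))⁻¹)) := by
  obtain ⟨C1, h1⟩ := qp_bdd hq
  obtain ⟨C2, h20, h2⟩ := rr_bdd hq
  have h10 : 0 ≤ C1 := (norm_nonneg _).trans (h1 0)
  rw [← tsum_mul_right]
  have hN : Tendsto (fun N : ℕ => (N : ℤ)) atTop atTop := tendsto_natCast_atTop_atTop
  refine tendsto_tsum_of_dominated_convergence (bound := fun j => C1 * C2 * C2 * ‖w j * D j‖)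
    (hs.norm.mul_left _) (fun j => ?_) (Eventually.of_forall fun N j => ?_)
  · have t1 : Tendsto (fun N : ℕ => qp q (2 * N + 1)) atTop (𝓝 (∏' n : ℕ, (1 - q ^ (n + 1)))) :=
      (qp_tendsto hq).comp (tendsto_atTop_mono (fun n => by simp only [id]; omega) tendsto_id)
    have t2 := rr_tendsto hq (fun N => N - j) (tendsto_atTop_add_const_right _ (-j) hN)
    have t3 := rr_tendsto hq (fun N => N + 1 + j) (by
      simpa [add_assoc] using tendsto_atTop_add_const_right _ (1 + j) hN)
    have := (((t1.const_mul (w j)).mul t2).mul t3).mul_const (D j)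
    have hne := qinf_ne hq
    convert! this using 2
    field_simp
  · have : aa q w N j * D j
        = qp q (2 * N + 1) * rr q (N - j) * rr q (N + 1 + j) * (w j * D j) := by
      unfold aa; ring
    rw [this, norm_mul, norm_mul, norm_mul]
    gcongr
    · exact h1 _
    · exact h2 _
    · exact h2 _
lemma pair_summable {q : ℂ} (hq : ‖q‖ < 1) (ν : ℕ) :
    Summable fun c : ℕ × ℕ => ((c.2 : ℂ) + 1) ^ ν * (q ^ (c.1 + 1)) ^ (c.2 + 1) := by
  have := summable_prod_mul_pow (𝕜 := ℂ) ν hq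
  rw [← (Equiv.prodCongr Equiv.pnatEquivNat Equiv.pnatEquivNat).symm.summable_iff] at this
  refine this.congr fun c => ?_
  simp [pow_mul]

lemma Phi_hasSum {q : ℂ} (hq : ‖q‖ < 1) (ν : ℕ) :
    HasSum (fun k : ℕ => ∑' n : ℕ, ((n : ℂ) + 1) ^ ν * (q ^ (k + 1)) ^ (n + 1)) (Phi ν q) := by
  have hs := pair_summable hq ν
  have h1 : HasSum (fun k : ℕ => ∑' n : ℕ, ((n : ℂ) + 1) ^ ν * (q ^ (k + 1)) ^ (n + 1))
      (∑' k : ℕ, ∑' n : ℕ, ((n : ℂ) + 1) ^ ν * (q ^ (k + 1)) ^ (n + 1)) := hs.prod.hasSum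
  have hc : ∑' k : ℕ, ∑' n : ℕ, ((n : ℂ) + 1) ^ ν * (q ^ (k + 1)) ^ (n + 1)
      = ∑' n : ℕ, ∑' k : ℕ, ((n : ℂ) + 1) ^ ν * (q ^ (k + 1)) ^ (n + 1) :=
    (Summable.tsum_comm (f := fun k n : ℕ => ((n : ℂ) + 1) ^ ν * (q ^ (k + 1)) ^ (n + 1)) hs).symm
  suffices h : Phi ν q = ∑' n : ℕ, ∑' k : ℕ, ((n : ℂ) + 1) ^ ν * (q ^ (k + 1)) ^ (n + 1) by
    rw [h, ← hc]; exact h1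
  unfold Phi
  refine tsum_congr fun n => ?_
  rw [tsum_mul_left, mul_div_assoc]
  congr 1
  have hx : ‖q ^ (n + 1)‖ < 1 := by
    rw [norm_pow]; exact pow_lt_one₀ (norm_nonneg q) hq (Nat.succ_ne_zero n)
  have : ∀ k : ℕ, (q ^ (k + 1)) ^ (n + 1) = q ^ (n + 1) * (q ^ (n + 1)) ^ k := by
    intro k; ring
  simp_rw [this]
  rw [tsum_mul_left, tsum_geometric_of_norm_lt_one hx, div_eq_mul_inv]

lemma L_summable {x : ℂ} (hx : ‖x‖ < 1) (ν : ℕ) :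
    Summable fun n : ℕ => ((n : ℂ) + 1) ^ ν * x ^ (n + 1) := by
  have h0 : Summable fun n : ℕ => (n : ℂ) ^ ν * x ^ n :=
    summable_pow_mul_geometric_of_norm_lt_one ν hx
  refine ((summable_nat_add_iff 1).mpr h0).congr fun n => ?_
  push_cast
  rfl

/-- polynomial Lambert sums -/
noncomputable def LL (ν : ℕ) (x : ℂ) : ℂ := ∑' n : ℕ, ((n : ℂ) + 1) ^ ν * x ^ (n + 1)

lemma L1 {x : ℂ} (hx : ‖x‖ < 1) : LL 1 x = x / (1 - x) ^ 2 := by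
  have h := (hasSum_choose_mul_geometric_of_norm_lt_one 1 hx).mul_left x
  have : HasSum (fun n : ℕ => ((n : ℂ) + 1) ^ 1 * x ^ (n + 1)) (x * (1 / (1 - x) ^ (1 + 1))) := by
    convert! h using 1
    ext n
    simp only [Nat.choose_one_right]
    push_cast
    ring
  rw [LL, this.tsum_eq]; ring

lemma L3 {x : ℂ} (hx : ‖x‖ < 1) : (LL 3 x - LL 1 x) / 6 = (x / (1 - x) ^ 2) ^ 2 := by
  have h := (hasSum_choose_mul_geometric_of_norm_lt_one 3 hx).mul_left (x ^ 2)
  have h2 : HasSum (fun n : ℕ => (((n : ℂ) + 1) ^ 3 * x ^ (n + 1)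
      - ((n : ℂ) + 1) ^ 1 * x ^ (n + 1)) / 6) (x ^ 2 * (1 / (1 - x) ^ (3 + 1))) := by
    rw [← hasSum_nat_add_iff' 1]
    convert! h using 1
    · ext n
      have := Nat.ascFactorial_eq_factorial_mul_choose n 3
      have h' : ((n + 3).choose 3 : ℂ) = (n + 1) * (n + 2) * (n + 3) / 6 := by
        have := congrArg (Nat.cast : ℕ → ℂ) this
        simp [Nat.ascFactorial, Nat.factorial] at this
        linear_combination (-1 / 6 : ℂ) * this
      rw [h']; push_cast; ring
    · simp
  have h3 := (((L_summable hx 3).hasSum.sub (L_summable hx 1).hasSum).div_const 6).unique h2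
  rw [LL, LL, h3, div_pow, ← pow_mul]; ring

lemma L5 {x : ℂ} (hx : ‖x‖ < 1) :
    (LL 5 x - 5 * LL 3 x + 4 * LL 1 x) / 120 = (x / (1 - x) ^ 2) ^ 3 := by
  have h := (hasSum_choose_mul_geometric_of_norm_lt_one 5 hx).mul_left (x ^ 3)
  have h2 : HasSum (fun n : ℕ => (((n : ℂ) + 1) ^ 5 * x ^ (n + 1)
      - 5 * (((n : ℂ) + 1) ^ 3 * x ^ (n + 1)) + 4 * (((n : ℂ) + 1) ^ 1 * x ^ (n + 1))) / 120)
      (x ^ 3 * (1 / (1 - x) ^ (5 + 1))) := by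
    rw [← hasSum_nat_add_iff' 2]
    convert! h using 1
    · ext n
      have := Nat.ascFactorial_eq_factorial_mul_choose n 5
      have h' : ((n + 5).choose 5 : ℂ)
          = (n + 1) * (n + 2) * (n + 3) * (n + 4) * (n + 5) / 120 := by
        have := congrArg (Nat.cast : ℕ → ℂ) this
        simp [Nat.ascFactorial, Nat.factorial] at this
        linear_combination (-1 / 120 : ℂ) * this
      rw [h']; push_cast; ring
    · simp [Finset.sum_range_succ]
      ring
  have h3 := ((((L_summable hx 5).hasSum.sub ((L_summable hx 3).hasSum.mul_left 5)).add
    ((L_summable hx 1).hasSum.mul_left 4)).div_const 120).unique h2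
  rw [LL, LL, LL, h3, div_pow, ← pow_mul]; ring

lemma pp_tendsto {q : ℂ} (hq : ‖q‖ < 1) :
    Tendsto (pp q 1) atTop (𝓝 (Phi 1 q)) ∧
    Tendsto (pp q 2) atTop (𝓝 ((Phi 3 q - Phi 1 q) / 6)) ∧
    Tendsto (pp q 3) atTop (𝓝 ((Phi 5 q - 5 * Phi 3 q + 4 * Phi 1 q) / 120)) := by
  have hx : ∀ k : ℕ, ‖q ^ (k + 1)‖ < 1 := fun k => by
    rw [norm_pow]; exact pow_lt_one₀ (norm_nonneg q) hq (Nat.succ_ne_zero k)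
  have p1 : HasSum (fun k : ℕ => LL 1 (q ^ (k + 1))) (Phi 1 q) := Phi_hasSum hq 1
  have p3 : HasSum (fun k : ℕ => LL 3 (q ^ (k + 1))) (Phi 3 q) := Phi_hasSum hq 3
  have p5 : HasSum (fun k : ℕ => LL 5 (q ^ (k + 1))) (Phi 5 q) := Phi_hasSum hq 5
  refine ⟨?_, ?_, ?_⟩
  · have : HasSum (fun k => yy q k ^ 1) (Phi 1 q) := by
      convert! p1 using 2 with k
      rw [L1 (hx k), pow_one, yy]
    exact this.tendsto_sum_nat
  · have : HasSum (fun k => yy q k ^ 2) ((Phi 3 q - Phi 1 q) / 6) := by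
      convert! (p3.sub p1).div_const 6 using 2 with k
      rw [L3 (hx k), yy]
    exact this.tendsto_sum_nat
  · have : HasSum (fun k => yy q k ^ 3) ((Phi 5 q - 5 * Phi 3 q + 4 * Phi 1 q) / 120) := by
      convert! ((p5.sub (p3.mul_left 5)).add (p1.mul_left 4)).div_const 120 using 2 with k
      rw [L5 (hx k), yy]
    exact this.tendsto_sum_nat

lemma key {q : ℂ} (hq0 : q ≠ 0) (hq : ‖q‖ < 1) {w : ℤ → ℂ}
    (hw : ∀ j, w (j + 1) = -(w j * q ^ (j + 1)))
    (hs : ∀ k : ℕ, Summable fun j : ℤ => w j * (j : ℂ) ^ k) :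
    ∑' j : ℤ, w j * (2 * (j : ℂ) + 1) ^ 7
      = 2 * w 0 * (∏' n : ℕ, (1 - q ^ (n + 1))) ^ 3 *
        (35 * (1 - 24 * Phi 1 q) ^ 3 - 42 * (1 - 24 * Phi 1 q) * (1 + 240 * Phi 3 q)
          + 16 * (1 - 504 * Phi 5 q)) / 9 := by
  have k0 := hs 0
  have k1 := hs 1
  have k2 := hs 2
  have k3 := hs 3
  have k4 := hs 4
  have k5 := hs 5
  have k6 := hs 6
  have k7 := hs 7
  have s0 : Summable fun j => w j * D0 j :=
    ((k1.mul_left 2).add k0).congr fun j => by simp only [D0]; ring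
  have s1 : Summable fun j => w j * D1 j :=
    (((k3.mul_left (2 / 6)).add (k2.mul_left (3 / 6))).add (k1.mul_left (1 / 6))).congr
      fun j => by simp only [D1]; ring
  have s2 : Summable fun j => w j * D2 j :=
    (((((k5.mul_left (2 / 120)).add (k4.mul_left (5 / 120))).add (k3.mul_left 0)).add
      (k2.mul_left (-5 / 120))).add (k1.mul_left (-2 / 120))).congr
      fun j => by simp only [D2]; ring
  have s3 : Summable fun j => w j * D3 j :=
    (((((((k7.mul_left (2 / 5040)).add (k6.mul_left (7 / 5040))).add
      (k5.mul_left (-7 / 5040))).add (k4.mul_left (-35 / 5040))).add (k3.mul_left 0)).add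
      (k3.mul_left (-7 / 5040))).add ((k2.mul_left (28 / 5040)).add
      (k1.mul_left (12 / 5040)))).congr
      fun j => by simp only [D3]; ring
  have hne := qinf_ne hq
  have hP := qp_tendsto hq
  obtain ⟨l1, l2, l3⟩ := pp_tendsto hq
  set Z := ∏' n : ℕ, (1 - q ^ (n + 1)) with hZ
  have u0 := tendsto_nhds_unique ((TT_tendsto hq D0 s0).congr fun N => (TT_eq hq0 hq hw N).1)
    ((hP.pow 2).const_mul (2 * w 0))
  have u1 := tendsto_nhds_unique ((TT_tendsto hq D1 s1).congr fun N => (TT_eq hq0 hq hw N).2.1)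
    (((hP.pow 2).const_mul (2 * w 0)).mul l1.neg)
  have u2 := tendsto_nhds_unique
    ((TT_tendsto hq D2 s2).congr fun N => (TT_eq hq0 hq hw N).2.2.1)
    (((hP.pow 2).const_mul (2 * w 0)).mul (((l1.pow 2).sub l2).div_const 2))
  have u3 := tendsto_nhds_unique
    ((TT_tendsto hq D3 s3).congr fun N => (TT_eq hq0 hq hw N).2.2.2)
    (((hP.pow 2).const_mul (2 * w 0)).mul
      ((((l1.pow 3).sub ((l1.const_mul 3).mul l2)).add (l3.const_mul 2)).neg.div_const 6))
  rw [← hZ] at u0 u1 u2 u3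
  rw [mul_inv_eq_iff_eq_mul₀ hne] at u0 u1 u2 u3
  have hsum : ∑' j : ℤ, w j * (2 * (j : ℂ) + 1) ^ 7
      = ∑' j, w j * D0 j + 2184 * ∑' j, w j * D1 j + 67200 * ∑' j, w j * D2 j
        + 322560 * ∑' j, w j * D3 j := by
    rw [← tsum_mul_left, ← tsum_mul_left, ← tsum_mul_left, ← s0.tsum_add (s1.mul_left _),
      ← (s0.add (s1.mul_left _)).tsum_add (s2.mul_left _),
      ← ((s0.add (s1.mul_left _)).add (s2.mul_left _)).tsum_add (s3.mul_left _)]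
    refine tsum_congr fun j => ?_
    simp only [D0, D1, D2, D3]
    ring
  rw [hsum, u0, u1, u2, u3]
  ring

/-- signed Gaussian weights -/
noncomputable def ww (τ : ℂ) (j : ℤ) : ℂ :=
  (-1) ^ j * Complex.exp (2 * Real.pi * Complex.I * τ * ((2 * (j : ℂ) + 1) ^ 2 / 8))

lemma ww_succ (τ : ℂ) (j : ℤ) :
    ww τ (j + 1) = -(ww τ j * Complex.exp (2 * Real.pi * Complex.I * τ) ^ (j + 1)) := by
  unfold ww
  rw [zpow_add_one₀ (by norm_num), ← Complex.exp_int_mul, mul_assoc ((-1 : ℂ) ^ j) (cexp _),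
    ← Complex.exp_add, mul_assoc, neg_one_mul, mul_neg]
  congr 3
  push_cast
  ring

lemma ww_summable {τ : ℂ} (hτ : 0 < τ.im) (k : ℕ) :
    Summable fun j : ℤ => ww τ j * (j : ℂ) ^ k := by
  refine (summable_pow_mul_jacobiTheta₂_term_bound (τ.im / 2) hτ k).of_norm_bounded fun j => ?_
  rw [norm_mul, norm_pow, mul_comm, ww, norm_mul, norm_zpow, norm_neg, norm_one, one_zpow,
    one_mul, Complex.norm_exp, Complex.norm_intCast]
  push_cast
  gcongr
  have h1 : (2 * Real.pi * Complex.I * τ * ((2 * (j : ℂ) + 1) ^ 2 / 8)).re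
      = -(Real.pi * τ.im * ((j : ℝ) ^ 2 + j + 1 / 4)) := by
    have : (2 * Real.pi * Complex.I * τ * ((2 * (j : ℂ) + 1) ^ 2 / 8))
        = ((Real.pi * ((j : ℝ) ^ 2 + j + 1 / 4) : ℝ) : ℂ) * (Complex.I * τ) := by
      push_cast; ring
    rw [this, Complex.re_ofReal_mul]
    simp
    ring
  rw [h1]
  have h2 : 0 ≤ Real.pi * τ.im * ((j : ℝ) + |(j : ℝ)| + 1 / 4) := by
    have := neg_abs_le (j : ℝ)
    have := Real.pi_pos
    have h3 : (0 : ℝ) ≤ (j : ℝ) + |(j : ℝ)| + 1 / 4 := by linarith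
    positivity
  nlinarith [h2]

lemma ww_even (τ : ℂ) (m : ℤ) : ww τ (2 * m) * (2 * ((2 * m : ℤ) : ℂ) + 1) ^ 7
    = Complex.exp (2 * Real.pi * Complex.I * τ * ((4 * (m : ℂ) + 1) ^ 2 / 8))
        * (4 * (m : ℂ) + 1) ^ 7 := by
  have : ((-1 : ℂ)) ^ (2 * m) = 1 := Even.neg_one_zpow (even_two_mul m)
  rw [ww, this, one_mul]
  push_cast
  ring_nf

lemma ww_odd (τ : ℂ) (m : ℤ) : ww τ (-1 - 2 * m) * (2 * ((-1 - 2 * m : ℤ) : ℂ) + 1) ^ 7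
    = Complex.exp (2 * Real.pi * Complex.I * τ * ((4 * (m : ℂ) + 1) ^ 2 / 8))
        * (4 * (m : ℂ) + 1) ^ 7 := by
  have : ((-1 : ℂ)) ^ (-1 - 2 * m) = -1 := Odd.neg_one_zpow ⟨-1 - m, by ring⟩
  rw [ww, this]
  have e : (2 * ((-1 - 2 * m : ℤ) : ℂ) + 1) = -(4 * (m : ℂ) + 1) := by push_cast; ring
  rw [e, neg_sq]
  ring

lemma split_tsum (f : ℤ → ℂ) (hf : Summable f) :
    ∑' j, f j = ∑' m : ℤ, f (2 * m) + ∑' m : ℤ, f (-1 - 2 * m) := by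
  have i1 : Function.Injective fun m : ℤ => 2 * m := fun a b h => by
    simp only at h; omega
  have i2 : Function.Injective fun m : ℤ => -1 - 2 * m := fun a b h => by
    simp only at h; omega
  have hc : IsCompl (Set.range fun m : ℤ => 2 * m) (Set.range fun m : ℤ => -1 - 2 * m) := by
    refine IsCompl.of_eq ?_ ?_
    · ext j
      simp only [Set.inf_eq_inter, Set.mem_inter_iff, Set.mem_range, Set.bot_eq_empty,
        Set.mem_empty_iff_false, iff_false]
      rintro ⟨⟨a, ha⟩, b, hb⟩
      omega
    · ext j
      simp only [Set.sup_eq_union, Set.mem_union, Set.mem_range, Set.top_eq_univ, Set.mem_univ,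
        iff_true]
      rcases Int.even_or_odd' j with ⟨c, h | h⟩
      · exact Or.inl ⟨c, h.symm⟩
      · exact Or.inr ⟨-1 - c, by omega⟩
  exact (HasSum.add_isCompl hc (i1.hasSum_range_iff.mpr (hf.comp_injective i1).hasSum)
    (i2.hasSum_range_iff.mpr (hf.comp_injective i2).hasSum)).tsum_eq

end S3

/-- With q = e^{2πiτ}, Im τ > 0, P = 1 − 24Φ₁, Q = 1 + 240Φ₃, R = 1 − 504Φ₅,
S₃(7) = ∑_{m∈ℤ} (4m+1)⁷ q^{(4m+1)²/8} = η(τ)³·(35P³ − 42PQ + 16R)/9. -/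
theorem S3_seven_eq (τ : ℂ) (hτ : 0 < τ.im) :
    (∑' m : ℤ, Complex.exp (2 * Real.pi * Complex.I * τ * ((4 * (m : ℂ) + 1) ^ 2 / 8))
        * (4 * (m : ℂ) + 1) ^ 7)
      = (Complex.exp (2 * Real.pi * Complex.I * τ / 24)
          * ∏' n : ℕ, (1 - Complex.exp (2 * Real.pi * Complex.I * τ) ^ (n + 1))) ^ 3
        * (35 * (1 - 24 * Phi 1 (Complex.exp (2 * Real.pi * Complex.I * τ))) ^ 3
            - 42 * (1 - 24 * Phi 1 (Complex.exp (2 * Real.pi * Complex.I * τ)))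
                * (1 + 240 * Phi 3 (Complex.exp (2 * Real.pi * Complex.I * τ)))
            + 16 * (1 - 504 * Phi 5 (Complex.exp (2 * Real.pi * Complex.I * τ)))) / 9 := by
  have hq0 := Complex.exp_ne_zero (2 * Real.pi * Complex.I * τ)
  have hq : ‖Complex.exp (2 * Real.pi * Complex.I * τ)‖ < 1 :=
    UpperHalfPlane.norm_exp_two_pi_I_lt_one ⟨τ, hτ⟩
  have hs := S3.ww_summable hτ
  have hf : Summable fun j : ℤ => S3.ww τ j * (2 * (j : ℂ) + 1) ^ 7 := by
    refine (((((((((hs 7).mul_left 128).add ((hs 6).mul_left 448)).add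
      ((hs 5).mul_left 672)).add ((hs 4).mul_left 560)).add ((hs 3).mul_left 280)).add
      ((hs 2).mul_left 84)).add ((hs 1).mul_left 14)).add (hs 0)).congr fun j => ?_
    ring
  have hk := S3.key hq0 hq (S3.ww_succ τ) hs
  rw [S3.split_tsum _ hf] at hk
  simp only [S3.ww_even, S3.ww_odd] at hk
  have h0 : S3.ww τ 0 = Complex.exp (2 * Real.pi * Complex.I * τ / 24) ^ 3 := by
    rw [S3.ww, ← Complex.exp_nat_mul]
    simp only [zpow_zero, one_mul]
    congr 1
    push_cast
    ring
  rw [h0] at hk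
  rw [mul_pow]
  linear_combination hk / 2
end
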